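/- There is a constant C > 0 such that the following holds. For every prime q, every integer n ≥ 1, every nonempty A ⊆ 𝔽_q^n with density α = |A|/q^n, and every γ ∈ (0,1], there is an affine subspace V ⊆ 𝔽_q^n (a coset of a linear subspace) of codimension at most C·(log(2/α))^5·(log(2/γ))^4 such that |(A+A) ∩ V| ≥ (1−γ)·|V|. -/

import Mathlib

open scoped Classical Pointwise
set_option linter.unusedSectionVars false


namespace KM
open Finset

variable {G : Type*} [AddCommGroup G] [Fintype G]

/-- Sum over differences. -/
lemma sum_diff (g : G → ℝ) : ∑ a : G, ∑ b : G, g (b - a) = (Fintype.card G : ℝ) * ∑ x, g x := by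
  have : ∀ a : G, ∑ b : G, g (b - a) = ∑ x, g x := fun a =>
    Fintype.sum_equiv (Equiv.subRight a) _ _ (fun _ => rfl)
  simp [this]

lemma sum_summ (g : G → ℝ) : ∑ a : G, ∑ b : G, g (a + b) = (Fintype.card G : ℝ) * ∑ x, g x := by
  have : ∀ a : G, ∑ b : G, g (a + b) = ∑ x, g x := fun a =>
    Fintype.sum_equiv (Equiv.addLeft a) _ _ (fun _ => rfl)
  simp [this]

/-- difference correlation -/
noncomputable def corr (f : G → ℝ) (x : G) : ℝ := ∑ y, f y * f (y + x)
/-- convolution -/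
noncomputable def conv (f : G → ℝ) (x : G) : ℝ := ∑ y, f y * f (x - y)

lemma corr_diff (f : G → ℝ) (a b : G) : corr f (b - a) = ∑ y, f (y + a) * f (y + b) := by
  unfold corr
  symm
  refine Fintype.sum_equiv (Equiv.addRight a) _ _ (fun y => ?_)
  simp only [Equiv.coe_addRight]
  congr 2; abel

lemma conv_sum (f : G → ℝ) (a b : G) : conv f (a + b) = ∑ y, f (y + a) * f (b - y) := by
  unfold conv
  symm
  refine Fintype.sum_equiv (Equiv.addRight a) _ _ (fun y => ?_)
  simp only [Equiv.coe_addRight]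
  congr 2; abel

/-- product over tuple -/
noncomputable def U (f : G → ℝ) {k : ℕ} (y : Fin k → G) (a : G) : ℝ := ∏ i, f (y i + a)

lemma moment_weight (f w : G → ℝ) (k : ℕ) :
    (Fintype.card G : ℝ) * ∑ x, w x * corr f x ^ k
      = ∑ y : Fin k → G, ∑ a, ∑ b, w (b - a) * (U f y a * U f y b) := by
  rw [← sum_diff (fun x => w x * corr f x ^ k)]
  rw [Finset.sum_comm (s := (univ : Finset (Fin k → G)))]
  refine Finset.sum_congr rfl fun a _ => ?_
  rw [Finset.sum_comm (s := (univ : Finset (Fin k → G)))]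
  refine Finset.sum_congr rfl fun b _ => ?_
  rw [corr_diff, Fintype.sum_pow, Finset.mul_sum]
  refine Finset.sum_congr rfl fun y _ => ?_
  simp only [U, Finset.prod_mul_distrib]

lemma moment (f : G → ℝ) (k : ℕ) :
    (Fintype.card G : ℝ) * ∑ x, corr f x ^ k = ∑ y : Fin k → G, (∑ a, U f y a) ^ 2 := by
  have := moment_weight f (fun _ => 1) k
  simp only [one_mul] at this
  rw [this]
  refine Finset.sum_congr rfl fun y _ => ?_
  rw [sq, Finset.sum_mul_sum]

lemma moment_conv (f : G → ℝ) (k : ℕ) :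
    (Fintype.card G : ℝ) * ∑ x, conv f x ^ k
      = ∑ y : Fin k → G, (∑ a, U f y a) * (∑ a, U f (-y) a) := by
  rw [← sum_summ (fun x => conv f x ^ k)]
  have : ∀ y : Fin k → G, (∑ a, U f y a) * (∑ a, U f (-y) a) = ∑ a, ∑ b, U f y a * U f (-y) b :=
    fun y => Finset.sum_mul_sum _ _ _ _
  simp only [this]
  rw [Finset.sum_comm (s := (univ : Finset (Fin k → G)))]
  refine Finset.sum_congr rfl fun a _ => ?_
  rw [Finset.sum_comm (s := (univ : Finset (Fin k → G)))]
  refine Finset.sum_congr rfl fun b _ => ?_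
  rw [conv_sum, Fintype.sum_pow]
  refine Finset.sum_congr rfl fun y _ => ?_
  simp only [U, Finset.prod_mul_distrib]
  congr 1
  refine Finset.prod_congr rfl fun i _ => ?_
  congr 1
  simp only [Pi.neg_apply]; abel

lemma card_pos' : (0 : ℝ) < (Fintype.card G : ℝ) := by
  exact_mod_cast Fintype.card_pos

lemma corr_moment_nonneg (f : G → ℝ) (k : ℕ) : 0 ≤ ∑ x, corr f x ^ k := by
  have h := moment f k
  have h2 : 0 ≤ (Fintype.card G : ℝ) * ∑ x, corr f x ^ k := by
    rw [h]; positivity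
  exact nonneg_of_mul_nonneg_right h2 card_pos'

lemma conv_le_corr (f : G → ℝ) (k : ℕ) : ∑ x, conv f x ^ k ≤ ∑ x, corr f x ^ k := by
  refine le_of_mul_le_mul_left ?_ (card_pos' (G := G))
  rw [moment, moment_conv]
  have h2 : ∑ y : Fin k → G, (∑ a, U f (-y) a) ^ 2 = ∑ y : Fin k → G, (∑ a, U f y a) ^ 2 :=
    Fintype.sum_equiv (Equiv.neg _) _ _ (fun _ => rfl)
  have h3 : ∑ y : Fin k → G, (∑ a, U f y a) * (∑ a, U f (-y) a)
      ≤ ∑ y : Fin k → G, ((∑ a, U f y a) ^ 2 / 2 + (∑ a, U f (-y) a) ^ 2 / 2) := by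
    refine Finset.sum_le_sum fun y _ => ?_
    nlinarith [sq_nonneg ((∑ a, U f y a) - (∑ a, U f (-y) a))]
  rw [Finset.sum_add_distrib, ← Finset.sum_div, ← Finset.sum_div, h2] at h3
  linarith

/-- indicator -/
noncomputable def ind (A : Finset G) (x : G) : ℝ := if x ∈ A then 1 else 0

lemma sum_ind (A : Finset G) : ∑ x, ind A x = A.card := by
  simp [ind]

lemma ind_nonneg (A : Finset G) (x : G) : 0 ≤ ind A x := by unfold ind; split_ifs <;> simp
lemma ind_le_one (A : Finset G) (x : G) : ind A x ≤ 1 := by unfold ind; split_ifs <;> simp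

lemma sum_shift (f : G → ℝ) (x : G) : ∑ y, f (y + x) = ∑ y, f y :=
  Fintype.sum_equiv (Equiv.addRight x) _ _ (fun _ => rfl)
lemma sum_refl (f : G → ℝ) (x : G) : ∑ y, f (x - y) = ∑ y, f y :=
  Fintype.sum_equiv (Equiv.subLeft x) _ _ (fun _ => rfl)

/-- Normalised autocorrelation `μ_A ∘ μ_A`. -/
noncomputable def FF (A : Finset G) (x : G) : ℝ :=
  (Fintype.card G : ℝ) / (A.card : ℝ) ^ 2 * corr (ind A) x

lemma corr_nonneg (A : Finset G) (x : G) : 0 ≤ corr (ind A) x :=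
  Finset.sum_nonneg fun _ _ => mul_nonneg (ind_nonneg _ _) (ind_nonneg _ _)

lemma FF_nonneg (A : Finset G) (x : G) : 0 ≤ FF A x :=
  mul_nonneg (by positivity) (corr_nonneg _ _)

/-- balanced function scaled: `1_A - α` -/
noncomputable def bal (A : Finset G) (x : G) : ℝ :=
  ind A x - (A.card : ℝ) / (Fintype.card G : ℝ)

lemma corr_bal (A : Finset G) (x : G) :
    corr (bal A) x = corr (ind A) x - (A.card : ℝ) ^ 2 / (Fintype.card G : ℝ) := by
  have hN := card_pos' (G := G)
  unfold corr bal
  have : ∀ y, (ind A y - (A.card : ℝ) / (Fintype.card G : ℝ)) *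
      (ind A (y + x) - (A.card : ℝ) / (Fintype.card G : ℝ)) =
      ind A y * ind A (y + x) - (A.card : ℝ) / (Fintype.card G : ℝ) * ind A y
       - (A.card : ℝ) / (Fintype.card G : ℝ) * ind A (y + x)
       + ((A.card : ℝ) / (Fintype.card G : ℝ)) ^ 2 := fun y => by ring
  simp only [this, Finset.sum_add_distrib, Finset.sum_sub_distrib, ← Finset.mul_sum,
    sum_shift, sum_ind, Finset.sum_const, Finset.card_univ, nsmul_eq_mul]
  field_simp
  ring

lemma conv_bal (A : Finset G) (x : G) :
    conv (bal A) x = conv (ind A) x - (A.card : ℝ) ^ 2 / (Fintype.card G : ℝ) := by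
  have hN := card_pos' (G := G)
  unfold conv bal
  have : ∀ y, (ind A y - (A.card : ℝ) / (Fintype.card G : ℝ)) *
      (ind A (x - y) - (A.card : ℝ) / (Fintype.card G : ℝ)) =
      ind A y * ind A (x - y) - (A.card : ℝ) / (Fintype.card G : ℝ) * ind A y
       - (A.card : ℝ) / (Fintype.card G : ℝ) * ind A (x - y)
       + ((A.card : ℝ) / (Fintype.card G : ℝ)) ^ 2 := fun y => by ring
  simp only [this, Finset.sum_add_distrib, Finset.sum_sub_distrib, ← Finset.mul_sum,
    sum_refl, sum_ind, Finset.sum_const, Finset.card_univ, nsmul_eq_mul]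
  field_simp
  ring

lemma conv_ind_zero (A : Finset G) (x : G) (hx : x ∉ A + A) : conv (ind A) x = 0 := by
  unfold conv
  refine Finset.sum_eq_zero fun y _ => ?_
  unfold ind
  by_cases h1 : y ∈ A
  · by_cases h2 : x - y ∈ A
    · exact absurd (by simpa using Finset.add_mem_add h1 h2) hx
    · simp [h2]
  · simp [h1]

/-- Moments of `F - 1`. -/
lemma FF_sub_one_moment (A : Finset G) (hA : A.Nonempty) (γ : ℝ)
    (hC : γ * (Fintype.card G : ℝ) ≤ ((univ \ (A + A)).card : ℝ)) (p : ℕ) (hp : Even p) :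
    γ * (Fintype.card G : ℝ) ≤ ∑ x, (FF A x - 1) ^ p := by
  have hN := card_pos' (G := G)
  have hA' : (0 : ℝ) < A.card := by exact_mod_cast hA.card_pos
  set c : ℝ := (Fintype.card G : ℝ) / (A.card : ℝ) ^ 2 with hc
  have hcpos : 0 < c := by positivity
  have e1 : ∀ x, FF A x - 1 = c * corr (bal A) x := fun x => by
    rw [corr_bal, FF]; simp only [hc]; field_simp
  have e2 : ∀ x, x ∉ A + A → c * conv (bal A) x = -1 := fun x hx => by
    rw [conv_bal, conv_ind_zero A x hx]; simp only [hc]; field_simp; ring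
  have h1 : ∑ x, (c * conv (bal A) x) ^ p ≤ ∑ x, (FF A x - 1) ^ p := by
    simp only [e1, mul_pow, ← Finset.mul_sum]
    exact mul_le_mul_of_nonneg_left (conv_le_corr _ _) (by positivity)
  refine le_trans (le_trans hC ?_) h1
  calc ((univ \ (A + A)).card : ℝ) = ∑ x ∈ univ \ (A + A), (1 : ℝ) := by simp
    _ = ∑ x ∈ univ \ (A + A), (c * conv (bal A) x) ^ p := by
        refine Finset.sum_congr rfl fun x hx => ?_
        rw [e2 x (by simpa using hx), hp.neg_one_pow]
    _ ≤ ∑ x, (c * conv (bal A) x) ^ p :=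
        Finset.sum_le_sum_of_subset_of_nonneg (Finset.subset_univ _)
          fun x _ _ => hp.pow_nonneg _

lemma FF_odd_moment (A : Finset G) (hA : A.Nonempty) (k : ℕ) :
    0 ≤ ∑ x, (FF A x - 1) ^ k := by
  have hN := card_pos' (G := G)
  have hA' : (0 : ℝ) < A.card := by exact_mod_cast hA.card_pos
  set c : ℝ := (Fintype.card G : ℝ) / (A.card : ℝ) ^ 2 with hc
  have hcpos : 0 < c := by positivity
  have e1 : ∀ x, FF A x - 1 = c * corr (bal A) x := fun x => by
    rw [corr_bal, FF]; simp only [hc]; field_simp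
  simp only [e1, mul_pow, ← Finset.mul_sum]
  exact mul_nonneg (by positivity) (corr_moment_nonneg _ _)

lemma key_ineq (t : ℝ) (ht : 1 / 4 ≤ t) : 64 * (9 / 8 : ℝ) ^ 27 * t ≤ (1 + t) ^ 27 := by
  have h1 : (1 + t) ^ 27 = (5 / 4 : ℝ) ^ 27 * (1 + (4 * t - 1) / 5) ^ 27 := by
    rw [← mul_pow]; congr 1; ring
  have h2 : 1 + (27 : ℕ) * ((4 * t - 1) / 5) ≤ (1 + (4 * t - 1) / 5) ^ 27 :=
    one_add_mul_le_pow (by linarith) 27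
  have h3 : 4 * t ≤ (1 + (4 * t - 1) / 5) ^ 27 := by
    refine le_trans ?_ h2
    push_cast
    linarith
  rw [h1]
  calc 64 * (9 / 8 : ℝ) ^ 27 * t = (16 * (9 / 8 : ℝ) ^ 27) * (4 * t) := by ring
    _ ≤ (5 / 4 : ℝ) ^ 27 * (4 * t) := by
        refine mul_le_mul_of_nonneg_right ?_ (by linarith)
        norm_num
    _ ≤ _ := mul_le_mul_of_nonneg_left h3 (by positivity)

lemma pointwise (t : ℝ) (ht : -1 ≤ t) (p : ℕ) (hp : Even p) :
    (64 * (9 / 8 : ℝ) ^ 27) ^ (p + 1) *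
      (t ^ (p + 1) / 2 + t ^ p / 8 - 3 / 8 * (1 / 4) ^ p) ≤ (1 + t) ^ (27 * (p + 1)) := by
  have hR : (0 : ℝ) ≤ (64 * (9 / 8 : ℝ) ^ 27) ^ (p + 1) := by positivity
  have hq : (0 : ℝ) < (1 / 4) ^ p := by positivity
  have hr : (0 : ℝ) ≤ (1 + t) ^ (27 * (p + 1)) := pow_nonneg (by linarith) _
  have htp : 0 ≤ t ^ p := hp.pow_nonneg _
  by_cases h : 1 / 4 ≤ t
  · have h1 := pow_le_pow_left₀ (by positivity) (key_ineq t h) (p + 1)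
    rw [← pow_mul, mul_pow] at h1
    refine le_trans (mul_le_mul_of_nonneg_left ?_ hR) h1
    rw [pow_succ]
    nlinarith
  · push Not at h
    refine le_trans (mul_nonpos_of_nonneg_of_nonpos hR ?_) hr
    by_cases h2 : -(1 / 4) ≤ t
    · have h3 : t ^ p ≤ (1 / 4) ^ p := by
        rw [← hp.pow_abs]
        exact pow_le_pow_left₀ (abs_nonneg _) (abs_le.2 ⟨h2, h.le⟩) _
      rw [pow_succ]
      nlinarith
    · push Not at h2
      rw [pow_succ]
      nlinarith

lemma big_moment (A : Finset G) (hA : A.Nonempty) (γ : ℝ)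
    (hC : γ * (Fintype.card G : ℝ) ≤ ((univ \ (A + A)).card : ℝ)) (p : ℕ) (hp : Even p)
    (hp4 : 4 ≤ p) (hγ : (1 / 2) ^ p ≤ γ) :
    128 * (9 / 8 : ℝ) ^ (27 * (p + 1)) * (Fintype.card G : ℝ)
      ≤ ∑ x, FF A x ^ (27 * (p + 1)) := by
  have hN := card_pos' (G := G)
  have h1 := FF_sub_one_moment A hA γ hC p hp
  have h2 := FF_odd_moment A hA (p + 1)
  set R : ℝ := (64 * (9 / 8 : ℝ) ^ 27) ^ (p + 1) with hRdef
  have hR : (0 : ℝ) < R := by positivity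
  have h3 : ∑ x, R * ((FF A x - 1) ^ (p + 1) / 2 + (FF A x - 1) ^ p / 8 - 3 / 8 * (1 / 4) ^ p)
      ≤ ∑ x, FF A x ^ (27 * (p + 1)) := by
    refine Finset.sum_le_sum fun x _ => ?_
    have := pointwise (FF A x - 1) (by linarith [FF_nonneg A x]) p hp
    simpa using this
  refine le_trans ?_ h3
  rw [← Finset.mul_sum, Finset.sum_sub_distrib, Finset.sum_add_distrib, ← Finset.sum_div,
    ← Finset.sum_div, Finset.sum_const, Finset.card_univ, nsmul_eq_mul]
  have h4 : (1 / 4 : ℝ) ^ p * 16 ≤ γ := by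
    refine le_trans ?_ hγ
    have e : (1 / 4 : ℝ) ^ p = (1 / 2) ^ p * (1 / 2) ^ p := by rw [← mul_pow]; norm_num
    have e2 : (1 / 2 : ℝ) ^ p ≤ (1 / 2) ^ 4 := pow_le_pow_of_le_one (by norm_num) (by norm_num) hp4
    have e3 : (0 : ℝ) < (1 / 2 : ℝ) ^ p := by positivity
    rw [e]; nlinarith
  have h5 : 128 * (9 / 8 : ℝ) ^ (27 * (p + 1)) ≤ R * (1 / 4) ^ p := by
    have e : R * (1 / 4) ^ p = (9 / 8 : ℝ) ^ (27 * (p + 1)) * (64 * 16 ^ p) := by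
      rw [hRdef, mul_pow, ← pow_mul, pow_succ 64 p]
      have : (16 : ℝ) ^ p = 64 ^ p * (1 / 4) ^ p := by rw [← mul_pow]; norm_num
      rw [this]; ring
    have e2 : (16 : ℝ) ^ 1 ≤ 16 ^ p := pow_le_pow_right₀ (by norm_num) (by omega)
    rw [e, mul_comm]
    refine mul_le_mul_of_nonneg_left (by linarith) (by positivity)
  have h6 : (1 / 4 : ℝ) ^ p * (Fintype.card G : ℝ) ≤
    (∑ x, (FF A x - 1) ^ (p + 1)) / 2 + (∑ x, (FF A x - 1) ^ p) / 8
      - (Fintype.card G : ℝ) * (3 / 8 * (1 / 4) ^ p) := by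
    have := mul_le_mul_of_nonneg_right h4 hN.le
    have q : 0 ≤ (1 / 4 : ℝ) ^ p * (Fintype.card G : ℝ) := by positivity
    nlinarith
  calc _ ≤ R * (1 / 4) ^ p * (Fintype.card G : ℝ) := mul_le_mul_of_nonneg_right h5 hN.le
    _ = R * ((1 / 4) ^ p * (Fintype.card G : ℝ)) := by ring
    _ ≤ _ := mul_le_mul_of_nonneg_left h6 hR.le

/-- Sifting. -/
lemma sift (A : Finset G) (hA : A.Nonempty) (P : ℕ)
    (hM : 128 * (9 / 8 : ℝ) ^ P * (Fintype.card G : ℝ) ≤ ∑ x, FF A x ^ P) :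
    ∃ B : Finset G, ((A.card : ℝ) / Fintype.card G) ^ P * Fintype.card G ≤ (B.card : ℝ) ∧
      B.Nonempty ∧
      63 / 64 * (B.card : ℝ) ^ 2
        ≤ ∑ a ∈ B, ∑ b ∈ B, (if 9 / 8 ≤ FF A (b - a) then (1 : ℝ) else 0) := by
  have hN := card_pos' (G := G)
  have hA' : (0 : ℝ) < A.card := by exact_mod_cast hA.card_pos
  set N : ℝ := (Fintype.card G : ℝ) with hNdef
  set c : ℝ := N / (A.card : ℝ) ^ 2 with hc
  have hcpos : 0 < c := by positivity
  set κ : ℝ := ((A.card : ℝ) / N) ^ P * N with hκ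
  have hκpos : 0 < κ := by positivity
  let w : G → ℝ := fun x => 1 - 64 * (if 9 / 8 ≤ FF A x then (0 : ℝ) else 1)
  have hw := moment_weight (ind A) w P
  -- total mass
  have hU : ∑ y : Fin P → G, ∑ a, U (ind A) y a = N * (A.card : ℝ) ^ P := by
    rw [Finset.sum_comm]
    have : ∀ a : G, ∑ y : Fin P → G, U (ind A) y a = (A.card : ℝ) ^ P := fun a => by
      unfold U
      rw [← Fintype.sum_pow (fun y => ind A (y + a)) P, sum_shift, sum_ind]
    simp [this, hNdef]
  -- lower bound
  have hlow : κ * (N * (A.card : ℝ) ^ P) < N * ∑ x, w x * corr (ind A) x ^ P := by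
    have e1 : ∀ x, corr (ind A) x = c⁻¹ * FF A x := fun x => by
      change corr (ind A) x = c⁻¹ * (c * corr (ind A) x)
      field_simp
    have e2 : ∑ x, (FF A x ^ P - 64 * (9 / 8 : ℝ) ^ P) ≤ ∑ x, w x * FF A x ^ P := by
      refine Finset.sum_le_sum fun x _ => ?_
      simp only [w]
      split_ifs with h
      · have : (0 : ℝ) ≤ (9 / 8 : ℝ) ^ P := by positivity
        linarith
      · have := pow_le_pow_left₀ (FF_nonneg A x) (not_le.1 h).le P
        linarith
    rw [Finset.sum_sub_distrib, Finset.sum_const, Finset.card_univ, nsmul_eq_mul] at e2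
    have e3 : 64 * N ≤ ∑ x, w x * FF A x ^ P := by
      refine le_trans ?_ e2
      have : (1 : ℝ) ≤ (9 / 8 : ℝ) ^ P := one_le_pow₀ (by norm_num)
      nlinarith
    have e4 : ∑ x, w x * corr (ind A) x ^ P = c⁻¹ ^ P * ∑ x, w x * FF A x ^ P := by
      rw [Finset.mul_sum]
      refine Finset.sum_congr rfl fun x _ => ?_
      rw [e1, mul_pow]; ring
    rw [e4]
    have e5 : κ * (N * (A.card : ℝ) ^ P) = N * (c⁻¹ ^ P * N) := by
      have : c⁻¹ ^ P = ((A.card : ℝ) / N) ^ P * (A.card : ℝ) ^ P := by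
        rw [← mul_pow]; congr 1; simp only [hc]; field_simp
      rw [this, hκ]; ring
    rw [e5]
    have hci : 0 < c⁻¹ ^ P := by positivity
    refine mul_lt_mul_of_pos_left (mul_lt_mul_of_pos_left ?_ hci) hN
    linarith
  rw [hw, ← hU, Finset.mul_sum] at hlow
  obtain ⟨y, -, hy⟩ := Finset.exists_lt_of_sum_lt hlow
  let B : Finset G := univ.filter fun b => ∀ i, y i + b ∈ A
  have hUB : ∀ a, U (ind A) y a = if a ∈ B then (1 : ℝ) else 0 := fun a => by
    simp only [U, ind, B, Finset.mem_filter, Finset.mem_univ, true_and]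
    rw [Finset.prod_boole]; simp
  have s1 : ∑ a, U (ind A) y a = B.card := by simp [hUB]
  have s2 : ∑ a, ∑ b, w (b - a) * (U (ind A) y a * U (ind A) y b)
      = ∑ a ∈ B, ∑ b ∈ B, w (b - a) := by
    simp [hUB]
  rw [s1, s2] at hy
  let Q : ℝ := ∑ a ∈ B, ∑ b ∈ B, (if 9 / 8 ≤ FF A (b - a) then (1 : ℝ) else 0)
  have s3 : ∑ a ∈ B, ∑ b ∈ B, w (b - a) = 64 * Q - 63 * (B.card : ℝ) ^ 2 := by
    have : ∀ x, w x = 64 * (if 9 / 8 ≤ FF A x then (1 : ℝ) else 0) - 63 := fun x => by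
      simp only [w]; split_ifs <;> norm_num
    simp only [this, Finset.sum_sub_distrib, ← Finset.mul_sum, Finset.sum_const, nsmul_eq_mul, Q]
    ring
  have s4 : Q ≤ (B.card : ℝ) ^ 2 := by
    calc Q ≤ ∑ a ∈ B, ∑ b ∈ B, (1 : ℝ) := by
          refine Finset.sum_le_sum fun a _ => Finset.sum_le_sum fun b _ => ?_
          split_ifs <;> norm_num
      _ = _ := by simp [sq]
  rw [s3] at hy
  have hB0 : (0 : ℝ) ≤ B.card := by positivity
  have hBpos : (0 : ℝ) < B.card := by
    rcases hB0.eq_or_lt with h | h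
    · rw [← h] at hy s4; nlinarith
    · exact h
  refine ⟨B, ?_, Finset.card_pos.1 (by exact_mod_cast hBpos), ?_⟩
  · have : κ * (B.card : ℝ) < (B.card : ℝ) * B.card := by nlinarith
    exact (lt_of_mul_lt_mul_right this hB0).le
  · have : 0 ≤ κ * (B.card : ℝ) := by positivity
    change 63 / 64 * (B.card : ℝ) ^ 2 ≤ Q
    linarith

end KM


namespace KM
open Finset

/-- Hoeffding mgf bound. -/
lemma mgf_bound {ι : Type*} (B : Finset ι) (u : ι → ℝ) (hu : ∀ b ∈ B, |u b| ≤ 1)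
    (h0 : ∑ b ∈ B, u b = 0) (t : ℝ) :
    ∑ b ∈ B, Real.exp (t * u b) ≤ B.card * Real.exp (t ^ 2 / 2) := by
  calc ∑ b ∈ B, Real.exp (t * u b) ≤ ∑ b ∈ B, (Real.cosh t + u b * Real.sinh t) := by
        refine Finset.sum_le_sum fun b hb => ?_
        have := Real.exp_mul_le_cosh_add_mul_sinh (hu b hb) t
        rw [mul_comm t]; exact this
    _ = B.card * Real.cosh t := by
        rw [Finset.sum_add_distrib, ← Finset.sum_mul, h0]; simp
    _ ≤ _ := mul_le_mul_of_nonneg_left (Real.cosh_le_exp_half_sq t) (by positivity)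

lemma hoeff_one {ι : Type*} (B : Finset ι) (u : ι → ℝ) (hu : ∀ b ∈ B, |u b| ≤ 1)
    (h0 : ∑ b ∈ B, u b = 0) (m : ℕ) (ε : ℝ) (hε : 0 ≤ ε) :
    (((Fintype.piFinset fun _ : Fin m => B).filter fun c => ε * m < ∑ i, u (c i)).card : ℝ)
      ≤ Real.exp (-(ε ^ 2 * m / 2)) * (B.card : ℝ) ^ m := by
  have h1 : (((Fintype.piFinset fun _ : Fin m => B).filter
      fun c => ε * m < ∑ i, u (c i)).card : ℝ)
      ≤ ∑ c ∈ Fintype.piFinset fun _ : Fin m => B,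
          Real.exp (-(ε ^ 2 * m)) * ∏ i, Real.exp (ε * u (c i)) := by
    rw [Finset.card_filter]
    push_cast
    refine Finset.sum_le_sum fun c _ => ?_
    rw [← Real.exp_sum, ← Real.exp_add, ← Finset.mul_sum]
    split_ifs with h
    · rw [Real.one_le_exp_iff]; nlinarith
    · positivity
  refine h1.trans ?_
  rw [← Finset.mul_sum, ← Finset.sum_pow' B (fun b => Real.exp (ε * u b)) m]
  have h2 := pow_le_pow_left₀ (Finset.sum_nonneg fun b _ => (Real.exp_pos _).le)
    (mgf_bound B u hu h0 ε) m
  refine (mul_le_mul_of_nonneg_left h2 (Real.exp_pos _).le).trans (le_of_eq ?_)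
  rw [mul_pow, ← Real.exp_nat_mul, mul_left_comm, ← Real.exp_add, mul_comm]
  congr 2; ring

lemma hoeff_two {ι : Type*} (B : Finset ι) (u : ι → ℝ) (hu : ∀ b ∈ B, |u b| ≤ 1)
    (h0 : ∑ b ∈ B, u b = 0) (m : ℕ) (ε : ℝ) (hε : 0 ≤ ε) :
    (((Fintype.piFinset fun _ : Fin m => B).filter fun c => ε * m < |∑ i, u (c i)|).card : ℝ)
      ≤ 2 * Real.exp (-(ε ^ 2 * m / 2)) * (B.card : ℝ) ^ m := by
  have h1 := hoeff_one B u hu h0 m ε hε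
  have h2 := hoeff_one B (fun b => - u b) (fun b hb => by simpa using hu b hb)
    (by simp [h0]) m ε hε
  have h3 : ((Fintype.piFinset fun _ : Fin m => B).filter fun c => ε * m < |∑ i, u (c i)|) ⊆
    ((Fintype.piFinset fun _ : Fin m => B).filter fun c => ε * m < ∑ i, u (c i)) ∪
    ((Fintype.piFinset fun _ : Fin m => B).filter fun c => ε * m < ∑ i, - u (c i)) := by
    intro c hc
    simp only [Finset.mem_filter, Finset.mem_union, Finset.sum_neg_distrib] at hc ⊢
    rcases lt_abs.1 hc.2 with h | h
    · exact Or.inl ⟨hc.1, h⟩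
    · exact Or.inr ⟨hc.1, h⟩
  have h4 := (Finset.card_le_card h3).trans (Finset.card_union_le _ _)
  have h5 : (((Fintype.piFinset fun _ : Fin m => B).filter
    fun c => ε * m < |∑ i, u (c i)|).card : ℝ) ≤
    (((Fintype.piFinset fun _ : Fin m => B).filter fun c => ε * m < ∑ i, u (c i)).card : ℝ) +
    (((Fintype.piFinset fun _ : Fin m => B).filter fun c => ε * m < ∑ i, - u (c i)).card : ℝ) := by
    exact_mod_cast h4
  linarith

variable {G : Type*} [AddCommGroup G] [Fintype G]

/-- averaged indicator -/
noncomputable def hh (B S : Finset G) (x : G) : ℝ := (∑ b ∈ B, ind S (x - b)) / B.card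

/-- sampled indicator -/
noncomputable def gg (S : Finset G) {m : ℕ} (c : Fin m → G) (x : G) : ℝ :=
  (∑ i, ind S (x - c i)) / m

lemma hh_mem (B S : Finset G) (x : G) : 0 ≤ hh B S x ∧ hh B S x ≤ 1 := by
  unfold hh
  refine ⟨div_nonneg (Finset.sum_nonneg fun _ _ => ind_nonneg _ _) (by positivity), ?_⟩
  refine div_le_one_of_le₀ ?_ (by positivity)
  calc ∑ b ∈ B, ind S (x - b) ≤ ∑ b ∈ B, 1 := Finset.sum_le_sum fun _ _ => ind_le_one _ _
    _ = _ := by simp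

lemma gg_mem (S : Finset G) {m : ℕ} (c : Fin m → G) (x : G) : 0 ≤ gg S c x ∧ gg S c x ≤ 1 := by
  unfold gg
  refine ⟨div_nonneg (Finset.sum_nonneg fun _ _ => ind_nonneg _ _) (by positivity), ?_⟩
  refine div_le_one_of_le₀ ?_ (by positivity)
  calc ∑ i, ind S (x - c i) ≤ ∑ i : Fin m, (1 : ℝ) := Finset.sum_le_sum fun _ _ => ind_le_one _ _
    _ = _ := by simp

/-- For fixed `x`, few tuples are bad. -/
lemma bad_tuples (B S : Finset G) (hB : B.Nonempty) (m : ℕ) (hm : 0 < m) (ε : ℝ) (hε : 0 ≤ ε)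
    (x : G) :
    (((Fintype.piFinset fun _ : Fin m => B).filter
      fun c => ε < |gg S c x - hh B S x|).card : ℝ)
      ≤ 2 * Real.exp (-(ε ^ 2 * m / 2)) * (B.card : ℝ) ^ m := by
  have hB' : (0 : ℝ) < B.card := by exact_mod_cast hB.card_pos
  have hm' : (0 : ℝ) < m := by exact_mod_cast hm
  have h := hoeff_two B (fun b => ind S (x - b) - hh B S x) (fun b _ => by
      have := hh_mem B S x
      have h1 := ind_nonneg S (x - b)
      have h2 := ind_le_one S (x - b)
      rw [abs_le]; constructor <;> linarith)
    (by
      rw [Finset.sum_sub_distrib, Finset.sum_const, nsmul_eq_mul, hh]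
      field_simp; ring) m ε hε
  refine le_trans ?_ h
  norm_cast
  refine Finset.card_le_card fun c hc => ?_
  simp only [Finset.mem_filter] at hc ⊢
  refine ⟨hc.1, ?_⟩
  have e : ∑ i, (ind S (x - c i) - hh B S x) = m * (gg S c x - hh B S x) := by
    rw [Finset.sum_sub_distrib, Finset.sum_const, Finset.card_univ, Fintype.card_fin,
      nsmul_eq_mul, gg]
    field_simp
  rw [e, abs_mul, abs_of_pos hm', mul_comm]
  exact mul_lt_mul_of_pos_left hc.2 hm'

/-- Croot–Sisask sampling. -/
lemma croot_sisask (B S : Finset G) (hB : B.Nonempty) (m : ℕ) (hm : 0 < m) (ε : ℝ)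
    (hε : 0 ≤ ε) :
    ∃ (T : Finset G) (c : Fin m → G), T.Nonempty ∧
      ((B.card : ℝ) / Fintype.card G) ^ m / 2 * Fintype.card G ≤ T.card ∧
      ∀ t ∈ T, ((univ.filter fun x => ε < |gg S c (x - t) - hh B S x|).card : ℝ)
        ≤ 4 * Real.exp (-(ε ^ 2 * m / 2)) * Fintype.card G := by
  have hB' : (0 : ℝ) < B.card := by exact_mod_cast hB.card_pos
  have hN := card_pos' (G := G)
  set N : ℝ := (Fintype.card G : ℝ) with hNdef
  set E : ℝ := Real.exp (-(ε ^ 2 * m / 2)) with hE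
  have hEpos : 0 < E := Real.exp_pos _
  let bad : (Fin m → G) → ℝ := fun c => ((univ.filter fun x => ε < |gg S c x - hh B S x|).card : ℝ)
  let X := Fintype.piFinset fun _ : Fin m => B
  let L := X.filter fun c => bad c ≤ 4 * E * N
  have hXc : (X.card : ℝ) = (B.card : ℝ) ^ m := by simp [X]
  have h1 : ∑ c ∈ X, bad c ≤ 2 * E * (B.card : ℝ) ^ m * N := by
    calc ∑ c ∈ X, bad c = ∑ c ∈ X, ∑ x, (if ε < |gg S c x - hh B S x| then (1 : ℝ) else 0) := by
          refine Finset.sum_congr rfl fun c _ => ?_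
          simp [bad]
      _ = ∑ x, ∑ c ∈ X, (if ε < |gg S c x - hh B S x| then (1 : ℝ) else 0) := Finset.sum_comm
      _ ≤ ∑ x : G, 2 * E * (B.card : ℝ) ^ m := by
          refine Finset.sum_le_sum fun x _ => ?_
          have := bad_tuples B S hB m hm ε hε x
          simpa [X, hE] using this
      _ = _ := by rw [Finset.sum_const, Finset.card_univ, nsmul_eq_mul]; ring
  have h2 : ((X.filter fun c => ¬ bad c ≤ 4 * E * N).card : ℝ) * (4 * E * N)
      ≤ ∑ c ∈ X, bad c := by
    calc _ = ∑ c ∈ X.filter (fun c => ¬ bad c ≤ 4 * E * N), (4 * E * N) := by simp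
      _ ≤ ∑ c ∈ X.filter (fun c => ¬ bad c ≤ 4 * E * N), bad c := by
          refine Finset.sum_le_sum fun c hc => ?_
          exact (not_le.1 (Finset.mem_filter.1 hc).2).le
      _ ≤ _ := Finset.sum_le_sum_of_subset_of_nonneg (Finset.filter_subset _ _)
          fun _ _ _ => Nat.cast_nonneg _
  have h3 : (L.card : ℝ) + ((X.filter fun c => ¬ bad c ≤ 4 * E * N).card : ℝ) = X.card := by
    exact_mod_cast Finset.card_filter_add_card_filter_not (s := X) (fun c => bad c ≤ 4 * E * N)
  have h4 : (B.card : ℝ) ^ m / 2 ≤ L.card := by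
    have h5 : ((X.filter fun c => ¬ bad c ≤ 4 * E * N).card : ℝ) * (4 * E * N)
      ≤ (B.card : ℝ) ^ m / 2 * (4 * E * N) := by
      refine (h2.trans h1).trans (le_of_eq ?_); ring
    have h6 := le_of_mul_le_mul_right h5 (by positivity)
    rw [hXc] at h3
    linarith
  -- pigeonhole
  let T : (Fin m → G) → Finset G := fun c => univ.filter fun t => (fun i => c i + t) ∈ L
  have h7 : ∑ c : Fin m → G, ((T c).card : ℝ) = N * L.card := by
    calc ∑ c : Fin m → G, ((T c).card : ℝ)
        = ∑ c : Fin m → G, ∑ t : G, (if (fun i => c i + t) ∈ L then (1 : ℝ) else 0) := by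
          refine Finset.sum_congr rfl fun c _ => ?_
          simp [T]
      _ = ∑ t : G, ∑ c : Fin m → G, (if (fun i => c i + t) ∈ L then (1 : ℝ) else 0) :=
          Finset.sum_comm
      _ = ∑ t : G, (L.card : ℝ) := by
          refine Finset.sum_congr rfl fun t _ => ?_
          have : ∑ c : Fin m → G, (if (fun i => c i + t) ∈ L then (1 : ℝ) else 0)
              = ∑ c : Fin m → G, (if c ∈ L then (1 : ℝ) else 0) :=
            Fintype.sum_equiv (Equiv.addRight (fun _ : Fin m => t)) _ _ (fun c => rfl)
          rw [this]; simp
      _ = _ := by simp [hNdef]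
  have h8 : ∃ c : Fin m → G, N * L.card / N ^ m ≤ (T c).card := by
    by_contra hcon
    push Not at hcon
    have : ∑ c : Fin m → G, ((T c).card : ℝ) < ∑ c : Fin m → G, N * L.card / N ^ m :=
      Finset.sum_lt_sum_of_nonempty Finset.univ_nonempty fun c _ => hcon c
    rw [h7, Finset.sum_const, Finset.card_univ, nsmul_eq_mul] at this
    have e : ((Fintype.card (Fin m → G) : ℕ) : ℝ) = N ^ m := by simp [hNdef]
    rw [e] at this
    have hNm : N ^ m ≠ 0 := by positivity
    rw [mul_div_cancel₀ _ hNm] at this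
    exact lt_irrefl _ this
  obtain ⟨c, hc⟩ := h8
  have h9 : ((B.card : ℝ) / N) ^ m / 2 * N ≤ (T c).card := by
    refine le_trans ?_ hc
    rw [div_pow, mul_comm N, mul_div_right_comm]
    refine mul_le_mul_of_nonneg_right ?_ hN.le
    rw [div_right_comm]
    exact div_le_div_of_nonneg_right h4 (by positivity)
  refine ⟨T c, c, ?_, h9, ?_⟩
  · have : (0 : ℝ) < (T c).card := lt_of_lt_of_le (by positivity) h9
    exact Finset.card_pos.1 (by exact_mod_cast this)
  · intro t ht
    have ht' : (fun i => c i + t) ∈ L := (Finset.mem_filter.1 ht).2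
    have := (Finset.mem_filter.1 ht').2
    have e : ∀ x, gg S (fun i => c i + t) x = gg S c (x - t) := fun x => by
      unfold gg
      congr 1
      refine Finset.sum_congr rfl fun i _ => ?_
      change ind S (x - (c i + t)) = ind S (x - t - c i)
      congr 1; abel
    simp only [bad, e] at this
    exact this

/-- `H(z)` -/
noncomputable def HH (B S : Finset G) (z : G) : ℝ := (∑ b ∈ B, hh B S (b + z)) / B.card

lemma HH_period (B S : Finset G) (hB : B.Nonempty) (m : ℕ) (hm : 0 < m) (ε : ℝ)
    (hε : 0 ≤ ε) :
    ∃ T : Finset G, T.Nonempty ∧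
      ((B.card : ℝ) / Fintype.card G) ^ m / 2 * Fintype.card G ≤ T.card ∧
      ∀ t ∈ T, ∀ t' ∈ T, ∀ z, |HH B S (z + t - t') - HH B S z| ≤
        2 * (ε + 4 * Real.exp (-(ε ^ 2 * m / 2)) / ((B.card : ℝ) / Fintype.card G)) := by
  have hB' : (0 : ℝ) < B.card := by exact_mod_cast hB.card_pos
  have hN := card_pos' (G := G)
  obtain ⟨T, c, hT, hTc, hbad⟩ := croot_sisask B S hB m hm ε hε
  refine ⟨T, hT, hTc, ?_⟩
  set N : ℝ := (Fintype.card G : ℝ) with hNdef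
  set η : ℝ := 4 * Real.exp (-(ε ^ 2 * m / 2)) with hη
  let J : G → ℝ := fun z => (∑ b ∈ B, gg S c (b + z)) / B.card
  have key : ∀ t ∈ T, ∀ z, |HH B S (z + t) - J z| ≤ ε + η / ((B.card : ℝ) / N) := by
    intro t ht z
    have e1 : HH B S (z + t) - J z
        = (∑ b ∈ B, (hh B S (b + (z + t)) - gg S c (b + z))) / B.card := by
      simp only [HH, J, Finset.sum_sub_distrib, sub_div]
    rw [e1, abs_div, abs_of_pos hB', div_le_iff₀ hB']
    let Z := univ.filter fun x => ε < |gg S c (x - t) - hh B S x|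
    calc |∑ b ∈ B, (hh B S (b + (z + t)) - gg S c (b + z))|
        ≤ ∑ b ∈ B, |hh B S (b + (z + t)) - gg S c (b + z)| := Finset.abs_sum_le_sum_abs _ _
      _ ≤ ∑ b ∈ B, (ε + ind Z (b + (z + t))) := by
          refine Finset.sum_le_sum fun b _ => ?_
          have h1 := hh_mem B S (b + (z + t))
          have h2 := gg_mem S c (b + z)
          have e2 : b + (z + t) - t = b + z := by abel
          by_cases h : b + (z + t) ∈ Z
          · have : ind Z (b + (z + t)) = 1 := by simp [ind, h]
            rw [this, abs_le]; constructor <;> linarith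
          · have h3 : ind Z (b + (z + t)) = 0 := by simp [ind, h]
            simp only [Z, Finset.mem_filter, Finset.mem_univ, true_and, not_lt, e2] at h
            rw [h3, abs_sub_comm]; linarith
      _ = ε * B.card + ∑ b ∈ B, ind Z (b + (z + t)) := by
          rw [Finset.sum_add_distrib]; simp [mul_comm]
      _ ≤ ε * B.card + ∑ b, ind Z (b + (z + t)) := by
          gcongr
          · intros; exact ind_nonneg _ _
          · exact Finset.subset_univ _
      _ = ε * B.card + Z.card := by rw [sum_shift, sum_ind]
      _ ≤ ε * B.card + η * N := by
          have := hbad t ht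
          gcongr
      _ = _ := by field_simp
  intro t ht t' ht' z
  have k1 := key t ht (z - t')
  have k2 := key t' ht' (z - t')
  have e1 : z - t' + t = z + t - t' := by abel
  have e2 : z - t' + t' = z := by abel
  rw [e1] at k1
  rw [e2] at k2
  rw [abs_le] at *
  constructor <;> linarith

end KM


namespace KM
open Finset

section chang
variable {q : ℕ} [Fact q.Prime] {G : Type*} [AddCommGroup G] [Fintype G] [Module (ZMod q) G]

/-- the standard character -/
noncomputable def ee (u : ZMod q) : ℂ := ZMod.stdAddChar (N := q) u

lemma ee_add (u v : ZMod q) : ee (u + v) = ee u * ee v := AddChar.map_add_eq_mul _ _ _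
lemma ee_zero : ee (0 : ZMod q) = 1 := AddChar.map_zero_eq_one _
lemma ee_norm (u : ZMod q) : ‖ee u‖ = 1 := AddChar.norm_apply _ _
lemma ee_neg (u : ZMod q) : ee (-u) = (starRingEnd ℂ) (ee u) := AddChar.map_neg_eq_conj _ _
lemma ee_sum : ∑ u : ZMod q, ee u = 0 := by
  have h : ZMod.stdAddChar (N := q) ≠ 0 := by
    intro h
    have h1 : ZMod.stdAddChar (N := q) 1 = ZMod.stdAddChar (N := q) 0 := by simp [h]
    exact one_ne_zero (ZMod.injective_stdAddChar h1)
  exact AddChar.sum_eq_zero_iff_ne_zero.2 h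

lemma pi_surj {ι : Type*} [Fintype ι] (φ : ι → Module.Dual (ZMod q) G)
    (hφ : LinearIndependent (ZMod q) φ) :
    Function.Surjective (LinearMap.pi φ : G →ₗ[ZMod q] (ι → ZMod q)) := by
  rw [← LinearMap.range_eq_top]
  by_contra hne
  obtain ⟨f, f0, hf⟩ := Submodule.exists_le_ker_of_lt_top _ (lt_top_iff_ne_top.2 hne)
  have hlin := Fintype.linearIndependent_iff.1 hφ (fun i => f (Pi.single i 1)) (by
    ext x
    have h1 : f (LinearMap.pi φ x) = 0 := hf ⟨x, rfl⟩
    rw [LinearMap.pi_apply_eq_sum_univ] at h1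
    simp only [LinearMap.coe_sum, Finset.sum_apply, LinearMap.smul_apply, LinearMap.zero_apply]
    rw [← h1]
    refine Finset.sum_congr rfl fun i _ => ?_
    simp only [LinearMap.pi_apply, smul_eq_mul]
    rw [mul_comm]
    congr 2
    ext j; simp [Pi.single_apply, eq_comm])
  apply f0
  ext i
  simpa using hlin i

lemma sum_comp_surj {H : Type*} [AddCommGroup H] [Fintype H] (Φ : G →+ H)
    (hΦ : Function.Surjective Φ) :
    ∃ K : ℕ, K * Fintype.card H = Fintype.card G ∧
      ∀ g : H → ℝ, ∑ x, g (Φ x) = K * ∑ u, g u := by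
  have hfib : ∀ u : H, (univ.filter fun x => Φ x = u).card = (univ.filter fun x => Φ x = 0).card :=
    fun u => AddMonoidHom.card_fiber_eq_of_mem_range Φ (hΦ u) (hΦ 0)
  have hsum : ∀ g : H → ℝ, ∑ x, g (Φ x) = ((univ.filter fun x => Φ x = 0).card : ℝ) * ∑ u, g u := by
    intro g
    rw [← Finset.sum_fiberwise (s := (univ : Finset G)) (g := Φ) (f := fun x => g (Φ x)),
      Finset.mul_sum]
    refine Finset.sum_congr rfl fun u _ => ?_
    rw [← hfib u]
    rw [Finset.sum_congr rfl (g := fun _ => g u) (fun x hx => by rw [(Finset.mem_filter.1 hx).2])]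
    simp
  refine ⟨_, ?_, hsum⟩
  have := hsum (fun _ => 1)
  simp only [Finset.sum_const, Finset.card_univ, nsmul_eq_mul, mul_one] at this
  exact_mod_cast this.symm

/-- Character sum -/
noncomputable def XX (T : Finset G) (φ : Module.Dual (ZMod q) G) : ℂ := ∑ t ∈ T, ee (φ t)

lemma riesz {ι : Type*} [Fintype ι] (φ : ι → Module.Dual (ZMod q) G)
    (hφ : LinearIndependent (ZMod q) φ) (c : ι → ℂ) (hc : ∀ i, ‖c i‖ = 1) (t : ℝ) :
    ∑ x : G, Real.exp (t * ∑ i, (c i * ee (φ i x)).re)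
      ≤ Fintype.card G * Real.exp (Fintype.card ι * (t ^ 2 / 2)) := by
  obtain ⟨K, hK, hsum⟩ := sum_comp_surj (LinearMap.pi φ : G →ₗ[ZMod q] (ι → ZMod q)).toAddMonoidHom
    (pi_surj φ hφ)
  have h1 := hsum (fun u => ∏ i, Real.exp (t * (c i * ee (u i)).re))
  have h2 : ∑ x : G, Real.exp (t * ∑ i, (c i * ee (φ i x)).re)
      = K * ∑ u : ι → ZMod q, ∏ i, Real.exp (t * (c i * ee (u i)).re) := by
    rw [← h1]
    refine Finset.sum_congr rfl fun x _ => ?_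
    rw [Finset.mul_sum, Real.exp_sum]
    rfl
  rw [h2, ← Fintype.piFinset_univ, Finset.sum_prod_piFinset univ
    (fun i u => Real.exp (t * (c i * ee u).re))]
  have h3 : ∏ i, ∑ u : ZMod q, Real.exp (t * (c i * ee u).re)
      ≤ ∏ _i : ι, ((Fintype.card (ZMod q) : ℝ) * Real.exp (t ^ 2 / 2)) := by
    refine Finset.prod_le_prod (fun i _ => Finset.sum_nonneg fun _ _ => (Real.exp_pos _).le)
      fun i _ => ?_
    refine mgf_bound univ (fun u => (c i * ee u).re) (fun u _ => ?_) ?_ t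
    · refine (Complex.abs_re_le_norm _).trans ?_
      rw [norm_mul, hc, ee_norm, one_mul]
    · rw [← Complex.re_sum, ← Finset.mul_sum, ee_sum]; simp
  have hK' : (K : ℝ) * (Fintype.card (ZMod q) : ℝ) ^ Fintype.card ι = Fintype.card G := by
    rw [← hK]; simp
  refine (mul_le_mul_of_nonneg_left h3 (Nat.cast_nonneg K)).trans (le_of_eq ?_)
  rw [Finset.prod_const, Finset.card_univ, mul_pow, ← mul_assoc, hK', ← Real.exp_nat_mul]

lemma chang {ι : Type*} [Fintype ι] (T : Finset G) (hT : T.Nonempty)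
    (φ : ι → Module.Dual (ZMod q) G)
    (hφ : LinearIndependent (ZMod q) φ) (hs : ∀ i, (T.card : ℝ) / 2 ≤ ‖XX T (φ i)‖) :
    (Fintype.card ι : ℝ) ≤ 8 * Real.log (Fintype.card G / T.card) := by
  have hT' : (0 : ℝ) < T.card := by exact_mod_cast hT.card_pos
  have hN := card_pos' (G := G)
  have hX : ∀ i, 0 < ‖XX T (φ i)‖ := fun i => lt_of_lt_of_le (by positivity) (hs i)
  let c : ι → ℂ := fun i => (starRingEnd ℂ) (XX T (φ i)) / ‖XX T (φ i)‖
  have hc : ∀ i, ‖c i‖ = 1 := fun i => by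
    simp only [c, norm_div, RCLike.norm_conj, Complex.norm_real, norm_norm]
    exact div_self (hX i).ne'
  have hcX : ∀ i, (c i * XX T (φ i)).re = ‖XX T (φ i)‖ := fun i => by
    have : c i * XX T (φ i) = ((‖XX T (φ i)‖ : ℝ) : ℂ) := by
      simp only [c]
      rw [div_mul_eq_mul_div, mul_comm, Complex.mul_conj, Complex.normSq_eq_norm_sq]
      have : ((‖XX T (φ i)‖ : ℝ) : ℂ) ≠ 0 := by exact_mod_cast (hX i).ne'
      field_simp
      push_cast; ring
    rw [this, Complex.ofReal_re]
  have h1 := riesz φ hφ c hc (1 / 2)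
  set d : ℝ := (Fintype.card ι : ℝ) with hd
  let Y : G → ℝ := fun x => ∑ i, (c i * ee (φ i x)).re
  have hY : d * (T.card / 2) ≤ ∑ x ∈ T, Y x := by
    simp only [Y]
    rw [Finset.sum_comm]
    have : ∀ i, ∑ x ∈ T, (c i * ee (φ i x)).re = ‖XX T (φ i)‖ := fun i => by
      rw [← hcX, ← Complex.re_sum, XX, Finset.mul_sum]
    simp only [this]
    calc d * (T.card / 2) = ∑ i : ι, (T.card / 2 : ℝ) := by simp [hd]
      _ ≤ _ := Finset.sum_le_sum fun i _ => hs i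
  have h2 : Real.exp (d / 4) * T.card ≤ ∑ x ∈ T, Real.exp (1 / 2 * Y x) := by
    calc Real.exp (d / 4) * T.card
        ≤ Real.exp (d / 4) * ∑ x ∈ T, (1 + (1 / 2 * Y x - d / 4)) := by
          refine mul_le_mul_of_nonneg_left ?_ (Real.exp_pos _).le
          rw [Finset.sum_add_distrib, Finset.sum_sub_distrib, ← Finset.mul_sum]
          simp only [Finset.sum_const, nsmul_eq_mul, mul_one]
          linarith
      _ = ∑ x ∈ T, Real.exp (d / 4) * (1 + (1 / 2 * Y x - d / 4)) := Finset.mul_sum _ _ _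
      _ ≤ _ := by
          refine Finset.sum_le_sum fun x _ => ?_
          have e : Real.exp (1 / 2 * Y x) = Real.exp (d / 4) * Real.exp (1 / 2 * Y x - d / 4) := by
            rw [← Real.exp_add]; congr 1; ring
          rw [e]
          refine mul_le_mul_of_nonneg_left ?_ (Real.exp_pos _).le
          rw [add_comm]; exact Real.add_one_le_exp _
  have h3 : ∑ x ∈ T, Real.exp (1 / 2 * Y x) ≤ ∑ x, Real.exp (1 / 2 * Y x) :=
    Finset.sum_le_sum_of_subset_of_nonneg (Finset.subset_univ _) fun _ _ _ => (Real.exp_pos _).le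
  have h4 : Real.exp (d / 4) * T.card ≤ Fintype.card G * Real.exp (d / 8) := by
    refine (h2.trans (h3.trans h1)).trans (le_of_eq ?_)
    congr 2; ring
  have h5 : Real.exp (d / 8) ≤ Fintype.card G / T.card := by
    rw [le_div_iff₀ hT']
    have e : Real.exp (d / 4) = Real.exp (d / 8) * Real.exp (d / 8) := by
      rw [← Real.exp_add]; congr 1; ring
    rw [e] at h4
    have := Real.exp_pos (d / 8)
    refine le_of_mul_le_mul_left ?_ this
    linarith
  have h6 := (Real.le_log_iff_exp_le (by positivity)).2 h5
  linarith

/-- Subspace annihilating the large spectrum. -/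
lemma chang_subspace (T : Finset G) (hT : T.Nonempty) :
    ∃ V : Submodule (ZMod q) G,
      (Module.finrank (ZMod q) G : ℝ) - Module.finrank (ZMod q) V
        ≤ 8 * Real.log (Fintype.card G / T.card) ∧
      ∀ φ : Module.Dual (ZMod q) G, (T.card : ℝ) / 2 ≤ ‖XX T φ‖ → ∀ v ∈ V, φ v = 0 := by
  let s : Set (Module.Dual (ZMod q) G) := {φ | (T.card : ℝ) / 2 ≤ ‖XX T φ‖}
  have : Finite (Module.Dual (ZMod q) G) := DFunLike.finite _
  obtain ⟨b, hbs, hspan, hli⟩ := exists_linearIndependent (ZMod q) s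
  have : Fintype b := Fintype.ofFinite b
  refine ⟨(Submodule.span (ZMod q) s).dualCoannihilator, ?_, ?_⟩
  · have h1 := Subspace.finrank_add_finrank_dualCoannihilator_eq (Submodule.span (ZMod q) s)
    have h2 : Module.finrank (ZMod q) (Submodule.span (ZMod q) s) = Fintype.card b := by
      rw [← hspan]
      exact (finrank_span_set_eq_card hli).trans (Set.toFinset_card b)
    have h3 := chang T hT (fun i : b => (i : Module.Dual (ZMod q) G)) hli (fun i => hbs i.2)
    rw [← h1, h2]
    push_cast
    linarith
  · intro φ hφ v hv
    exact (Submodule.mem_dualCoannihilator v).1 hv φ (Submodule.subset_span hφ)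

end chang

end KM


namespace KM
open Finset

section fourier
variable {q : ℕ} [Fact q.Prime] {G : Type*} [AddCommGroup G] [Fintype G] [Module (ZMod q) G]
  [Fintype (Module.Dual (ZMod q) G)]

lemma card_dual : Fintype.card (Module.Dual (ZMod q) G) = Fintype.card G := by
  rw [Module.card_eq_pow_finrank (K := ZMod q) (V := G),
    Module.card_eq_pow_finrank (K := ZMod q) (V := Module.Dual (ZMod q) G),
    Subspace.dual_finrank_eq]

lemma orth (x : G) : ∑ φ : Module.Dual (ZMod q) G, ee (φ x)
    = if x = 0 then (Fintype.card G : ℂ) else 0 := by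
  split_ifs with h
  · simp [h, ee_zero, card_dual]
  · obtain ⟨φ₀, hφ₀⟩ : ∃ φ : Module.Dual (ZMod q) G, φ x ≠ 0 := by
      by_contra hcon
      push Not at hcon
      exact h ((Module.forall_dual_apply_eq_zero_iff (ZMod q) x).1 hcon)
    have h1 : ∑ φ : Module.Dual (ZMod q) G, ee (φ x)
        = ee (φ₀ x) * ∑ φ : Module.Dual (ZMod q) G, ee (φ x) := by
      rw [Finset.mul_sum]
      symm
      refine Fintype.sum_equiv (Equiv.addLeft φ₀) _ _ (fun φ => ?_)
      simp [ee_add]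
    have h2 : ee (φ₀ x) ≠ 1 := by
      intro h2
      rw [← ee_zero (q := q)] at h2
      exact hφ₀ (ZMod.injective_stdAddChar h2)
    have h3 : (ee (φ₀ x) - 1) * ∑ φ : Module.Dual (ZMod q) G, ee (φ x) = 0 := by
      rw [sub_mul, one_mul, ← h1, sub_self]
    exact (mul_eq_zero.1 h3).resolve_left (sub_ne_zero.2 h2)

lemma XX_normsq (B : Finset G) (φ : Module.Dual (ZMod q) G) :
    ((‖XX B φ‖ ^ 2 : ℝ) : ℂ) = ∑ b ∈ B, ∑ b' ∈ B, ee (φ (b - b')) := by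
  rw [← Complex.normSq_eq_norm_sq, ← Complex.mul_conj, XX, map_sum, Finset.sum_mul_sum]
  refine Finset.sum_congr rfl fun b _ => Finset.sum_congr rfl fun b' _ => ?_
  rw [map_sub, sub_eq_add_neg, ee_add, ee_neg]

lemma parseval (B : Finset G) :
    ∑ φ : Module.Dual (ZMod q) G, ‖XX B φ‖ ^ 2 = (Fintype.card G : ℝ) * B.card := by
  have h : ((∑ φ : Module.Dual (ZMod q) G, ‖XX B φ‖ ^ 2 : ℝ) : ℂ)
      = (((Fintype.card G : ℝ) * B.card : ℝ) : ℂ) := by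
    rw [Complex.ofReal_sum]
    simp only [XX_normsq]
    rw [Finset.sum_comm]
    have : ∀ b ∈ B, ∑ φ : Module.Dual (ZMod q) G, ∑ b' ∈ B, ee (φ (b - b'))
        = (Fintype.card G : ℂ) := by
      intro b hb
      rw [Finset.sum_comm]
      simp only [orth, sub_eq_zero]
      simp [hb]
    rw [Finset.sum_congr rfl this]
    simp [mul_comm]
  exact_mod_cast h

lemma ind_expand (S : Finset G) (x : G) :
    ((ind S x : ℝ) : ℂ) = (Fintype.card G : ℂ)⁻¹ *
      ∑ φ : Module.Dual (ZMod q) G, (∑ s ∈ S, ee (φ (-s))) * ee (φ x) := by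
  have hN : (Fintype.card G : ℂ) ≠ 0 := by exact_mod_cast (card_pos' (G := G)).ne'
  have : ∀ φ : Module.Dual (ZMod q) G, (∑ s ∈ S, ee (φ (-s))) * ee (φ x)
      = ∑ s ∈ S, ee (φ (x - s)) := fun φ => by
    rw [Finset.sum_mul]
    refine Finset.sum_congr rfl fun s _ => ?_
    rw [← ee_add, ← map_add]; congr 2; abel
  simp only [this]
  rw [Finset.sum_comm]
  simp only [orth, sub_eq_zero, ind]
  by_cases h : x ∈ S <;> simp [h, hN]

/-- Fourier coefficients of `HH`. -/
noncomputable def cc (B S : Finset G) (φ : Module.Dual (ZMod q) G) : ℂ :=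
  (Fintype.card G : ℂ)⁻¹ * (∑ s ∈ S, ee (φ (-s))) * ((‖XX B φ‖ ^ 2 : ℝ) : ℂ) / (B.card : ℂ) ^ 2

lemma HH_expand (B S : Finset G) (z : G) :
    ((HH B S z : ℝ) : ℂ) = ∑ φ : Module.Dual (ZMod q) G, cc B S φ * ee (φ z) := by
  have e1 : ((HH B S z : ℝ) : ℂ) = (∑ b ∈ B, ∑ b' ∈ B, ((ind S (b + z - b') : ℝ) : ℂ))
      / (B.card : ℂ) ^ 2 := by
    simp only [HH, hh]
    push_cast
    rw [← Finset.sum_div, div_div, sq]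
  rw [e1]
  simp only [ind_expand (q := q), cc, XX_normsq]
  rw [Finset.sum_div]
  simp only [Finset.mul_sum, Finset.sum_div, Finset.sum_mul]
  -- both sides: triple sums
  have e2 : ∀ b ∈ B, ∑ b' ∈ B, ∑ φ : Module.Dual (ZMod q) G, ∑ s ∈ S,
      (Fintype.card G : ℂ)⁻¹ * (ee (φ (-s)) * ee (φ (b + z - b'))) / (B.card : ℂ) ^ 2
      = ∑ φ : Module.Dual (ZMod q) G, ∑ b' ∈ B, ∑ s ∈ S,
      (Fintype.card G : ℂ)⁻¹ * (ee (φ (-s)) * ee (φ (b + z - b'))) / (B.card : ℂ) ^ 2 :=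
    fun b _ => Finset.sum_comm
  rw [Finset.sum_congr rfl e2, Finset.sum_comm]
  refine Finset.sum_congr rfl fun φ _ => ?_
  refine Finset.sum_congr rfl fun b _ => ?_
  refine Finset.sum_congr rfl fun b' _ => ?_
  refine Finset.sum_congr rfl fun s _ => ?_
  have : b + z - b' = (b - b') + z := by abel
  rw [this, map_add, ee_add]
  ring

lemma cc_sum (B S : Finset G) (hB : B.Nonempty) :
    ∑ φ : Module.Dual (ZMod q) G, ‖cc B S φ‖ ≤ (Fintype.card G : ℝ) / B.card := by
  have hB' : (0 : ℝ) < B.card := by exact_mod_cast hB.card_pos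
  have hN := card_pos' (G := G)
  have h1 : ∀ φ : Module.Dual (ZMod q) G, ‖cc B S φ‖ ≤ ‖XX B φ‖ ^ 2 / (B.card : ℝ) ^ 2 := by
    intro φ
    simp only [cc, norm_div, norm_mul, norm_inv, norm_pow, Complex.norm_natCast,
      Complex.norm_real, norm_norm]
    refine div_le_div_of_nonneg_right ?_ (by positivity)
    have h2 : ‖∑ s ∈ S, ee (φ (-s))‖ ≤ Fintype.card G := by
      refine (norm_sum_le _ _).trans ?_
      simp only [ee_norm, Finset.sum_const, nsmul_eq_mul, mul_one]
      exact_mod_cast Finset.card_le_univ S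
    have h3 : (Fintype.card G : ℝ)⁻¹ * ‖∑ s ∈ S, ee (φ (-s))‖ ≤ 1 := by
      rw [inv_mul_le_iff₀ hN]; linarith
    exact mul_le_of_le_one_left (by positivity) h3
  calc _ ≤ ∑ φ : Module.Dual (ZMod q) G, ‖XX B φ‖ ^ 2 / (B.card : ℝ) ^ 2 :=
        Finset.sum_le_sum fun φ _ => h1 φ
    _ = _ := by rw [← Finset.sum_div, parseval]; field_simp

end fourier

section avg
variable {G : Type*} [AddCommGroup G] [Fintype G]

/-- iterated averaging -/
noncomputable def PP (T : Finset G) (f : G → ℝ) : ℕ → G → ℝ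
  | 0 => f
  | k + 1 => fun z => (∑ t ∈ T, ∑ t' ∈ T, PP T f k (z + t - t')) / (T.card : ℝ) ^ 2

lemma avg_close (T : Finset G) (hT : T.Nonempty) (F : G → G → ℝ) (a e : ℝ)
    (h : ∀ t ∈ T, ∀ t' ∈ T, |F t t' - a| ≤ e) :
    |(∑ t ∈ T, ∑ t' ∈ T, F t t') / (T.card : ℝ) ^ 2 - a| ≤ e := by
  have hT' : (0 : ℝ) < T.card := by exact_mod_cast hT.card_pos
  have e1 : (∑ t ∈ T, ∑ t' ∈ T, F t t') / (T.card : ℝ) ^ 2 - a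
      = (∑ t ∈ T, ∑ t' ∈ T, (F t t' - a)) / (T.card : ℝ) ^ 2 := by
    simp only [Finset.sum_sub_distrib, Finset.sum_const, nsmul_eq_mul]
    field_simp
  rw [e1, abs_div, abs_of_pos (by positivity : (0 : ℝ) < (T.card : ℝ) ^ 2),
    div_le_iff₀ (by positivity)]
  calc _ ≤ ∑ t ∈ T, ∑ t' ∈ T, |F t t' - a| :=
        (Finset.abs_sum_le_sum_abs _ _).trans
          (Finset.sum_le_sum fun t _ => Finset.abs_sum_le_sum_abs _ _)
    _ ≤ ∑ t ∈ T, ∑ t' ∈ T, e :=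
        Finset.sum_le_sum fun t ht => Finset.sum_le_sum fun t' ht' => h t ht t' ht'
    _ = _ := by simp; ring

lemma PP_close (T : Finset G) (hT : T.Nonempty) (f : G → ℝ) (e : ℝ)
    (h : ∀ t ∈ T, ∀ t' ∈ T, ∀ z, |f (z + t - t') - f z| ≤ e) (k : ℕ) (z : G) :
    |PP T f k z - f z| ≤ k * e := by
  induction k generalizing z with
  | zero => simp [PP]
  | succ k ih =>
    have := avg_close T hT (fun t t' => PP T f k (z + t - t')) (f z) ((k + 1 : ℕ) * e) (by
      intro t ht t' ht'
      have h1 := ih (z + t - t')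
      have h2 := h t ht t' ht' z
      push_cast
      rw [abs_le] at *
      constructor <;> linarith)
    exact this

end avg

section ap
variable {q : ℕ} [Fact q.Prime] {G : Type*} [AddCommGroup G] [Fintype G] [Module (ZMod q) G]

lemma PP_expand [Fintype (Module.Dual (ZMod q) G)] (T B S : Finset G) (k : ℕ) (z : G) :
    ((PP T (HH B S) k z : ℝ) : ℂ) = ∑ φ : Module.Dual (ZMod q) G,
      cc B S φ * (((‖XX T φ‖ / T.card) ^ 2 : ℝ) : ℂ) ^ k * ee (φ z) := by
  induction k generalizing z with
  | zero => simp [PP, HH_expand (q := q)]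
  | succ k ih =>
    simp only [PP]
    rw [Complex.ofReal_div, Complex.ofReal_sum]
    simp only [Complex.ofReal_sum, ih]
    have e2 : ∀ t ∈ T, ∑ t' ∈ T, ∑ φ : Module.Dual (ZMod q) G,
        cc B S φ * (((‖XX T φ‖ / T.card) ^ 2 : ℝ) : ℂ) ^ k * ee (φ (z + t - t'))
        = ∑ φ : Module.Dual (ZMod q) G, ∑ t' ∈ T,
        cc B S φ * (((‖XX T φ‖ / T.card) ^ 2 : ℝ) : ℂ) ^ k * ee (φ (z + t - t')) :=
      fun t _ => Finset.sum_comm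
    rw [Finset.sum_congr rfl e2, Finset.sum_comm, Finset.sum_div]
    refine Finset.sum_congr rfl fun φ _ => ?_
    have e3 : (((‖XX T φ‖ / T.card) ^ 2 : ℝ) : ℂ)
        = (∑ t ∈ T, ∑ t' ∈ T, ee (φ (t - t'))) / (T.card : ℂ) ^ 2 := by
      rw [← XX_normsq, div_pow]; push_cast; rfl
    have e4 : ∑ t ∈ T, ∑ t' ∈ T,
        cc B S φ * (((‖XX T φ‖ / T.card) ^ 2 : ℝ) : ℂ) ^ k * ee (φ (z + t - t'))
        = cc B S φ * (((‖XX T φ‖ / T.card) ^ 2 : ℝ) : ℂ) ^ k * ee (φ z) *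
          ∑ t ∈ T, ∑ t' ∈ T, ee (φ (t - t')) := by
      rw [Finset.mul_sum]
      refine Finset.sum_congr rfl fun t _ => ?_
      rw [Finset.mul_sum]
      refine Finset.sum_congr rfl fun t' _ => ?_
      have : z + t - t' = z + (t - t') := by abel
      rw [this, map_add, ee_add]; ring
    rw [e4]
    generalize (((‖XX T φ‖ / T.card) ^ 2 : ℝ) : ℂ) = θ at e3 ⊢
    rw [pow_succ θ k]
    nth_rewrite 3 [e3]
    push_cast
    ring

lemma ap_core (T B S : Finset G) (hT : T.Nonempty) (hB : B.Nonempty) (e : ℝ)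
    (h : ∀ t ∈ T, ∀ t' ∈ T, ∀ z, |HH B S (z + t - t') - HH B S z| ≤ e) (k : ℕ)
    (v : G) (hv : ∀ φ : Module.Dual (ZMod q) G, (T.card : ℝ) / 2 ≤ ‖XX T φ‖ → φ v = 0) :
    |HH B S v - HH B S 0| ≤ 2 * k * e + 2 * (1 / 4) ^ k * (Fintype.card G / B.card) := by
  have : Finite (Module.Dual (ZMod q) G) := DFunLike.finite _
  let _ : Fintype (Module.Dual (ZMod q) G) := Fintype.ofFinite _
  have hT' : (0 : ℝ) < T.card := by exact_mod_cast hT.card_pos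
  have h1 := PP_close T hT (HH B S) e h k v
  have h2 := PP_close T hT (HH B S) e h k 0
  have h3 : |PP T (HH B S) k v - PP T (HH B S) k 0|
      ≤ 2 * (1 / 4) ^ k * (Fintype.card G / B.card) := by
    have e1 : ((PP T (HH B S) k v - PP T (HH B S) k 0 : ℝ) : ℂ)
        = ∑ φ : Module.Dual (ZMod q) G,
          cc B S φ * (((‖XX T φ‖ / T.card) ^ 2 : ℝ) : ℂ) ^ k * (ee (φ v) - 1) := by
      rw [Complex.ofReal_sub, PP_expand (q := q), PP_expand (q := q), ← Finset.sum_sub_distrib]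
      refine Finset.sum_congr rfl fun φ _ => ?_
      rw [map_zero, ee_zero]; ring
    rw [← Real.norm_eq_abs, ← Complex.norm_real, e1]
    refine (norm_sum_le _ _).trans ?_
    calc _ ≤ ∑ φ : Module.Dual (ZMod q) G, ‖cc B S φ‖ * (2 * (1 / 4) ^ k) := by
          refine Finset.sum_le_sum fun φ _ => ?_
          rw [norm_mul, norm_mul, mul_assoc]
          refine mul_le_mul_of_nonneg_left ?_ (norm_nonneg _)
          by_cases hφ : (T.card : ℝ) / 2 ≤ ‖XX T φ‖
          · rw [hv φ hφ, ee_zero]; simp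
          · have h4 : (‖XX T φ‖ / T.card) ≤ 1 / 2 := by
              rw [div_le_iff₀ hT']; linarith
            have h5 : ‖(((‖XX T φ‖ / T.card) ^ 2 : ℝ) : ℂ) ^ k‖ ≤ (1 / 4) ^ k := by
              rw [norm_pow, Complex.norm_real, Real.norm_of_nonneg (by positivity)]
              refine pow_le_pow_left₀ (by positivity) ?_ k
              have := pow_le_pow_left₀ (by positivity) h4 2
              refine this.trans (by norm_num)
            have h6 : ‖ee (φ v) - 1‖ ≤ 2 := by
              refine (norm_sub_le _ _).trans ?_
              rw [ee_norm, norm_one]; norm_num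
            calc _ ≤ (1 / 4 : ℝ) ^ k * 2 :=
                  mul_le_mul h5 h6 (norm_nonneg _) (by positivity)
              _ = _ := by ring
      _ = (∑ φ : Module.Dual (ZMod q) G, ‖cc B S φ‖) * (2 * (1 / 4) ^ k) := by
          rw [Finset.sum_mul]
      _ ≤ (Fintype.card G / B.card) * (2 * (1 / 4) ^ k) :=
          mul_le_mul_of_nonneg_right (cc_sum B S hB) (by positivity)
      _ = _ := by ring
  rw [abs_le] at *
  constructor <;> linarith

/-- explicit constant -/
noncomputable def C0 : ℝ := 8 * (60 * 1024 ^ 2 * 169 + 16)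

lemma almost_period (B S : Finset G) (hB : B.Nonempty) :
    ∃ V : Submodule (ZMod q) G,
      (Module.finrank (ZMod q) G : ℝ) - Module.finrank (ZMod q) V
        ≤ C0 * Real.log (2 / (B.card / Fintype.card G)) ^ 4 ∧
      ∀ v ∈ V, |HH B S v - HH B S 0| ≤ 1 / 64 := by
  have hB' : (0 : ℝ) < B.card := by exact_mod_cast hB.card_pos
  have hN := card_pos' (G := G)
  set β : ℝ := B.card / Fintype.card G with hβ
  have hβpos : 0 < β := by positivity
  have hβ1 : β ≤ 1 := by
    rw [hβ, div_le_one hN]; exact_mod_cast Finset.card_le_univ B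
  set l : ℝ := Real.log (2 / β) with hl
  have hexpl : Real.exp l = 2 / β := Real.exp_log (by positivity)
  have hl2 : Real.log 2 ≤ l := Real.log_le_log (by norm_num) (by
    rw [le_div_iff₀ hβpos]; linarith)
  have hlh : 1 / 2 ≤ l := by linarith [Real.log_two_gt_d9]
  set k : ℕ := ⌈l + 5⌉₊ with hk
  have hk1 : l + 5 ≤ k := Nat.le_ceil _
  have hk2 : (k : ℝ) ≤ 13 * l := by
    have := Nat.ceil_lt_add_one (by linarith : 0 ≤ l + 5)
    linarith
  have hkpos : (0 : ℝ) < k := by linarith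
  set ε : ℝ := 1 / (1024 * k) with hε
  have hεpos : 0 < ε := by positivity
  set m : ℕ := ⌈60 * l * (1024 * k) ^ 2⌉₊ with hm
  have hm1 : 60 * l * (1024 * k) ^ 2 ≤ m := Nat.le_ceil _
  have hmpos : (0 : ℝ) < m := lt_of_lt_of_le (by positivity) hm1
  have hm2 : (m : ℝ) ≤ (60 * 1024 ^ 2 * 169 + 8) * l ^ 3 := by
    have h1 := Nat.ceil_lt_add_one (by positivity : 0 ≤ 60 * l * (1024 * (k : ℝ)) ^ 2)
    have h2 : (k : ℝ) ^ 2 ≤ (13 * l) ^ 2 := pow_le_pow_left₀ hkpos.le hk2 2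
    have h3 : (1 / 2 : ℝ) ^ 3 ≤ l ^ 3 := pow_le_pow_left₀ (by norm_num) hlh 3
    have h4 : 60 * l * (1024 * (k : ℝ)) ^ 2 ≤ 60 * l * (1024 ^ 2 * (13 * l) ^ 2) := by
      rw [mul_pow]; gcongr
    have h5 : 60 * l * (1024 ^ 2 * (13 * l) ^ 2) = 60 * 1024 ^ 2 * 169 * l ^ 3 := by ring
    rw [h5] at h4
    rw [← hm] at h1
    linarith
  obtain ⟨T, hT, hTc, hper⟩ := HH_period B S hB m (by exact_mod_cast hmpos) ε hεpos.le
  rw [← hβ] at hTc hper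
  have hT' : (0 : ℝ) < T.card := by exact_mod_cast hT.card_pos
  obtain ⟨V, hV1, hV2⟩ := chang_subspace (q := q) T hT
  refine ⟨V, hV1.trans ?_, fun v hv => ?_⟩
  · have h1 : (Fintype.card G : ℝ) / T.card ≤ 2 * (1 / β) ^ m := by
      rw [div_le_iff₀ hT']
      have : 2 * (1 / β) ^ m * (β ^ m / 2 * Fintype.card G) = Fintype.card G := by
        rw [one_div, inv_pow]; field_simp
      rw [← this]
      rw [this]
      calc (Fintype.card G : ℝ) = 2 * (1 / β) ^ m * (β ^ m / 2 * Fintype.card G) := this.symm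
        _ ≤ _ := mul_le_mul_of_nonneg_left hTc (by positivity)
    have h2 : Real.log (Fintype.card G / T.card) ≤ Real.log 2 + m * Real.log (1 / β) := by
      refine (Real.log_le_log (by positivity) h1).trans (le_of_eq ?_)
      rw [Real.log_mul (by norm_num) (by positivity), Real.log_pow]
    have h3 : Real.log (1 / β) ≤ l := Real.log_le_log (by positivity) (by gcongr; norm_num)
    have h4 : m * Real.log (1 / β) ≤ m * l := mul_le_mul_of_nonneg_left h3 hmpos.le
    have h5 : (m : ℝ) * l ≤ (60 * 1024 ^ 2 * 169 + 8) * l ^ 3 * l :=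
      mul_le_mul_of_nonneg_right hm2 (by linarith)
    have h6 : l ≤ 8 * l ^ 4 := by
      have h3 : (1 / 2 : ℝ) ^ 3 ≤ l ^ 3 := pow_le_pow_left₀ (by norm_num) hlh 3
      have : l ^ 4 = l * l ^ 3 := by ring
      rw [this]; nlinarith
    have h7 : C0 * l ^ 4 = 8 * ((60 * 1024 ^ 2 * 169 + 8) * l ^ 3 * l + 8 * l ^ 4) := by
      unfold C0; ring
    rw [h7]
    linarith
  · have h1 := ap_core T B S hT hB _ hper k v (fun φ hφ => hV2 φ hφ v hv)
    refine h1.trans ?_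
    set E := Real.exp (-(ε ^ 2 * m / 2)) with hE
    -- first error
    have hE1 : E ≤ β / (4096 * k) := by
      have h2 : 30 * l ≤ ε ^ 2 * m / 2 := by
        have : ε ^ 2 * (60 * l * (1024 * k) ^ 2) ≤ ε ^ 2 * m :=
          mul_le_mul_of_nonneg_left hm1 (by positivity)
        have e : ε ^ 2 * (60 * l * (1024 * k) ^ 2) = 60 * l := by
          rw [hε]; field_simp
        linarith
      have h3 : 8 + k + l ≤ 30 * l := by linarith
      have h4 : (4096 * k) / β ≤ Real.exp (8 + k + l) := by
        rw [Real.exp_add, Real.exp_add, hexpl]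
        have a1 : (2048 : ℝ) ≤ Real.exp 8 := by
          have := Real.exp_one_gt_d9
          have e : Real.exp 8 = Real.exp 1 ^ 8 := by rw [← Real.exp_nat_mul]; norm_num
          rw [e]
          calc (2048 : ℝ) ≤ 2.7 ^ 8 := by norm_num
            _ ≤ _ := pow_le_pow_left₀ (by norm_num) (by linarith) 8
        have a2 : (k : ℝ) ≤ Real.exp k := by linarith [Real.add_one_le_exp (k : ℝ)]
        calc (4096 * k) / β = 2048 * k * (2 / β) := by ring
          _ ≤ _ := by gcongr
      have h5 : Real.exp (8 + k + l) ≤ Real.exp (ε ^ 2 * m / 2) :=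
        Real.exp_le_exp.2 (h3.trans h2)
      rw [hE, Real.exp_neg]
      calc (Real.exp (ε ^ 2 * m / 2))⁻¹ ≤ ((4096 * k) / β)⁻¹ :=
            inv_anti₀ (by positivity) (h4.trans h5)
        _ = _ := inv_div _ _
    have hA1 : 2 * k * (2 * (ε + 4 * E / β)) ≤ 1 / 128 := by
      have : 4 * E / β ≤ ε := by
        calc 4 * E / β ≤ 4 * (β / (4096 * k)) / β := by gcongr
          _ = ε := by rw [hε]; field_simp; norm_num
      calc 2 * k * (2 * (ε + 4 * E / β)) ≤ 2 * k * (2 * (ε + ε)) := by gcongr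
        _ = 1 / 128 := by rw [hε]; field_simp; norm_num
    have hA2 : 2 * (1 / 4) ^ k * (Fintype.card G / B.card : ℝ) ≤ 1 / 128 := by
      have e1 : (Fintype.card G / B.card : ℝ) = Real.exp l / 2 := by
        rw [hexpl, hβ]; field_simp
      have e2 : (1 / 4 : ℝ) ^ k ≤ Real.exp (-k) := by
        have : Real.exp (-(k : ℝ)) = Real.exp (-1) ^ k := by
          rw [← Real.exp_nat_mul]; congr 1; ring
        rw [this]
        refine pow_le_pow_left₀ (by norm_num) ?_ k
        rw [Real.exp_neg, one_div]
        exact inv_anti₀ (Real.exp_pos _) (by linarith [Real.exp_one_lt_d9])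
      have e3 : (128 : ℝ) ≤ Real.exp 5 := by
        have := Real.exp_one_gt_d9
        have e : Real.exp 5 = Real.exp 1 ^ 5 := by rw [← Real.exp_nat_mul]; norm_num
        rw [e]
        calc (128 : ℝ) ≤ 2.7 ^ 5 := by norm_num
          _ ≤ _ := pow_le_pow_left₀ (by norm_num) (by linarith) 5
      rw [e1]
      calc 2 * (1 / 4) ^ k * (Real.exp l / 2) ≤ 2 * Real.exp (-k) * (Real.exp l / 2) := by gcongr
        _ = Real.exp (-k + l) := by rw [Real.exp_add]; ring
        _ ≤ Real.exp (-5) := Real.exp_le_exp.2 (by linarith)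
        _ ≤ 1 / 128 := by
            rw [Real.exp_neg, one_div]
            exact inv_anti₀ (by norm_num) e3
    linarith

end ap

end KM


namespace KM
open Finset

section incr
variable {G : Type*} [AddCommGroup G] [Fintype G]

lemma HH_mul (B S : Finset G) (hB : B.Nonempty) (z : G) :
    HH B S z * (B.card : ℝ) ^ 2 = ∑ b ∈ B, ∑ b' ∈ B, ind S (b + z - b') := by
  have hB' : (B.card : ℝ) ≠ 0 := by exact_mod_cast hB.card_pos.ne'
  unfold HH hh
  rw [← Finset.sum_div]
  field_simp

lemma choose_p (γ : ℝ) (h0 : 0 < γ) (h1 : γ ≤ 1) : ∃ p : ℕ, Even p ∧ 4 ≤ p ∧ (1 / 2 : ℝ) ^ p ≤ γ ∧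
    ((27 * (p + 1) : ℕ) : ℝ) ≤ 324 * Real.log (2 / γ) := by
  set L := Real.log (2 / γ) with hL
  have hl2 : 0.6931 < Real.log 2 := by have := Real.log_two_gt_d9; linarith
  have hLe : L = Real.log 2 - Real.log γ := Real.log_div (by norm_num) h0.ne'
  have hlg : Real.log γ ≤ 0 := Real.log_nonpos h0.le h1
  have hLpos : 0.6931 < L := by linarith
  have hm1 : L ≤ ⌈L⌉₊ := Nat.le_ceil L
  have hm2 : (⌈L⌉₊ : ℝ) < L + 1 := Nat.ceil_lt_add_one (by linarith)
  have hm0 : 1 ≤ ⌈L⌉₊ := Nat.one_le_ceil_iff.2 (by linarith)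
  refine ⟨4 * ⌈L⌉₊, ⟨2 * ⌈L⌉₊, by ring⟩, by omega, ?_, ?_⟩
  · rw [← Real.log_le_log_iff (by positivity) h0, Real.log_pow]
    rw [one_div, Real.log_inv]
    push_cast
    nlinarith
  · push_cast
    nlinarith

noncomputable def C1 : ℝ := C0 * 324 ^ 4

lemma C0_pos : 0 < C0 := by unfold C0; norm_num

lemma C1_pos : 0 < C1 := by have := C0_pos; unfold C1; positivity

lemma ratio_le_one (A : Finset G) : (A.card : ℝ) / Fintype.card G ≤ 1 := by
  have hN := card_pos' (G := G)
  rw [div_le_one hN]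
  exact_mod_cast Finset.card_le_univ A

variable {q : ℕ} [Fact q.Prime] [Module (ZMod q) G]

lemma increment (A : Finset G) (hA : A.Nonempty) (γ : ℝ) (h0 : 0 < γ) (h1 : γ ≤ 1)
    (hC : γ * (Fintype.card G : ℝ) ≤ ((univ \ (A + A)).card : ℝ)) :
    ∃ V : Submodule (ZMod q) G, ∃ x : G,
      (Module.finrank (ZMod q) G : ℝ) - Module.finrank (ZMod q) V
        ≤ C1 * Real.log (2 / (A.card / Fintype.card G)) ^ 4 * Real.log (2 / γ) ^ 4 ∧
      (17 / 16 : ℝ) * (A.card / Fintype.card G) * Fintype.card V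
        ≤ ((univ : Finset V).filter (fun v : V => x + (v : G) ∈ A)).card := by
  have hN := card_pos' (G := G)
  have hA' : (0 : ℝ) < A.card := by exact_mod_cast hA.card_pos
  obtain ⟨p, hp, hp4, hpγ, hpL⟩ := choose_p γ h0 h1
  set P := 27 * (p + 1) with hP
  have hP1 : 1 ≤ P := by omega
  obtain ⟨B, hBc, hB, hBS⟩ := sift A hA P (big_moment A hA γ hC p hp hp4 hpγ)
  have hB' : (0 : ℝ) < B.card := by exact_mod_cast hB.card_pos
  set S : Finset G := univ.filter (fun x => 9 / 8 ≤ FF A x) with hS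
  have hind : ∀ x, ind S x = if 9 / 8 ≤ FF A x then (1 : ℝ) else 0 := by
    intro x; simp [ind, hS]
  have hH0 : 63 / 64 ≤ HH B S 0 := by
    have h := HH_mul B S hB 0
    rw [Finset.sum_comm] at h
    simp only [add_zero, hind] at h
    rw [← h] at hBS
    exact le_of_mul_le_mul_right hBS (by positivity)
  obtain ⟨V, hVc, hV⟩ := almost_period (q := q) B S hB
  set α : ℝ := A.card / Fintype.card G with hα
  have hαpos : 0 < α := by positivity
  have hα1 : α ≤ 1 := ratio_le_one A
  have hlog2 : 0 < Real.log 2 := Real.log_pos (by norm_num)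
  have hlα : Real.log α ≤ 0 := Real.log_nonpos hαpos.le hα1
  have hL0 : 0 ≤ Real.log (2 / γ) := Real.log_nonneg (by rw [le_div_iff₀ h0]; linarith)
  have hLa : Real.log (2 / α) = Real.log 2 - Real.log α := Real.log_div (by norm_num) hαpos.ne'
  have hcard : (0 : ℝ) < Fintype.card V := card_pos'
  have key : ∃ x : G, (17 / 16 : ℝ) * α * Fintype.card V ≤ ∑ v : V, ind A (x + (v : G)) := by
    by_contra hcon
    push Not at hcon
    have hF : ∀ y, ∑ v : V, FF A (y + v) ≤ 17 / 16 * Fintype.card V := by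
      intro y
      have e : ∑ v : V, FF A (y + v) = (Fintype.card G : ℝ) / (A.card : ℝ) ^ 2 *
          ∑ z, ind A z * ∑ v : V, ind A ((z + y) + (v : G)) := by
        unfold FF corr
        rw [← Finset.mul_sum, Finset.sum_comm]
        congr 1
        refine Finset.sum_congr rfl fun z _ => ?_
        rw [Finset.mul_sum]
        refine Finset.sum_congr rfl fun v _ => ?_
        rw [add_assoc]
      rw [e]
      calc _ ≤ (Fintype.card G : ℝ) / (A.card : ℝ) ^ 2 *
          ∑ z, ind A z * ((17 / 16 : ℝ) * α * Fintype.card V) := by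
            gcongr with z _
            · exact ind_nonneg A z
            · exact (hcon _).le
        _ = _ := by
            rw [← Finset.sum_mul, sum_ind, hα]
            field_simp
    have hHv : ∀ v : V, 62 / 64 ≤ HH B S v := by
      intro v
      have := abs_le.1 (hV v v.2)
      linarith [this.1]
    have hlow : 9 / 8 * (62 / 64) * (B.card : ℝ) ^ 2 * Fintype.card V
        ≤ ∑ v : V, ∑ b ∈ B, ∑ b' ∈ B, FF A (b + v - b') := by
      have : ∀ v : V, 9 / 8 * (62 / 64) * (B.card : ℝ) ^ 2
          ≤ ∑ b ∈ B, ∑ b' ∈ B, FF A (b + v - b') := by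
        intro v
        calc _ ≤ 9 / 8 * (HH B S v * (B.card : ℝ) ^ 2) := by
              have := mul_le_mul_of_nonneg_right (hHv v) (sq_nonneg (B.card : ℝ))
              linarith
          _ = ∑ b ∈ B, ∑ b' ∈ B, 9 / 8 * ind S (b + v - b') := by
              rw [HH_mul B S hB, Finset.mul_sum]
              simp_rw [Finset.mul_sum]
          _ ≤ _ := by
              refine Finset.sum_le_sum fun b _ => Finset.sum_le_sum fun b' _ => ?_
              rw [hind]
              split_ifs with h
              · linarith
              · have := FF_nonneg A (b + v - b'); linarith
      calc _ = ∑ v : V, 9 / 8 * (62 / 64) * (B.card : ℝ) ^ 2 := by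
            simp; ring
        _ ≤ _ := Finset.sum_le_sum fun v _ => this v
    have hup : ∑ v : V, ∑ b ∈ B, ∑ b' ∈ B, FF A (b + v - b')
        ≤ (B.card : ℝ) ^ 2 * (17 / 16 * Fintype.card V) := by
      rw [Finset.sum_comm]
      calc _ ≤ ∑ b ∈ B, (B.card : ℝ) * (17 / 16 * Fintype.card V) := by
            refine Finset.sum_le_sum fun b _ => ?_
            rw [Finset.sum_comm]
            calc _ ≤ ∑ b' ∈ B, (17 / 16 * (Fintype.card V : ℝ)) := by
                  refine Finset.sum_le_sum fun b' _ => ?_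
                  have := hF (b - b')
                  simpa only [add_sub_right_comm] using this
              _ = _ := by simp
        _ = _ := by simp; ring
    have : 0 < (B.card : ℝ) ^ 2 * Fintype.card V := by positivity
    nlinarith
  obtain ⟨x, hx⟩ := key
  refine ⟨V, x, ?_, ?_⟩
  · refine hVc.trans ?_
    set β : ℝ := B.card / Fintype.card G with hβ
    have hβpos : 0 < β := by positivity
    have hβ1 : β ≤ 1 := ratio_le_one B
    have hαβ : α ^ P ≤ β := by rw [hβ, le_div_iff₀ hN]; exact hBc
    have hlb : Real.log (2 / β) = Real.log 2 - Real.log β := Real.log_div (by norm_num) hβpos.ne'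
    have hlβ : Real.log β ≤ 0 := Real.log_nonpos hβpos.le hβ1
    have h2 : (P : ℝ) * Real.log α ≤ Real.log β := by
      rw [← Real.log_pow]; exact Real.log_le_log (by positivity) hαβ
    have hP1' : (1 : ℝ) ≤ P := by exact_mod_cast hP1
    have h3 : Real.log (2 / β) ≤ 324 * Real.log (2 / γ) * Real.log (2 / α) := by
      have : Real.log (2 / β) ≤ P * Real.log (2 / α) := by rw [hlb, hLa]; nlinarith
      refine this.trans ?_
      exact mul_le_mul_of_nonneg_right hpL (by rw [hLa]; linarith)
    have h4 : 0 ≤ Real.log (2 / β) := by rw [hlb]; linarith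
    calc _ ≤ C0 * (324 * Real.log (2 / γ) * Real.log (2 / α)) ^ 4 := by
          have := C0_pos
          gcongr
      _ = _ := by unfold C1; ring
  · refine hx.trans (le_of_eq ?_)
    simp [ind]

end incr

noncomputable def K1 : ℝ := C1 / Real.log (17 / 16)

lemma iterate {q : ℕ} [Fact q.Prime] (γ : ℝ) (h0 : 0 < γ) (h1 : γ ≤ 1) (d : ℕ) :
    ∀ (G : Type) [AddCommGroup G] [Fintype G] [Module (ZMod q) G] (A : Finset G), A.Nonempty →
      Fintype.card G ≤ d →
      ∃ W : Submodule (ZMod q) G, ∃ x : G,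
      (Module.finrank (ZMod q) G : ℝ) - Module.finrank (ZMod q) W
        ≤ K1 * Real.log (2 / (A.card / Fintype.card G)) ^ 4 *
          Real.log (1 / (A.card / Fintype.card G)) * Real.log (2 / γ) ^ 4 ∧
      (1 - γ) * (Nat.card W : ℝ) ≤ (((A + A).filter fun v => v - x ∈ W).card : ℝ) := by
  have hc0 : 0 < Real.log (17 / 16) := Real.log_pos (by norm_num)
  have hK1 : 0 < K1 := div_pos C1_pos hc0
  have hKC : K1 * Real.log (17 / 16) = C1 := div_mul_cancel₀ _ hc0.ne'
  have hlog2 : 0 < Real.log 2 := Real.log_pos (by norm_num)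
  induction d with
  | zero =>
    intro G _ _ _ A hA hd
    have := Fintype.card_pos_iff.2 ⟨hA.choose⟩
    omega
  | succ d ih =>
    intro G _ _ _ A hA hd
    have hN := card_pos' (G := G)
    have hA' : (0 : ℝ) < A.card := by exact_mod_cast hA.card_pos
    set α : ℝ := A.card / Fintype.card G with hα
    have hαpos : 0 < α := by positivity
    have hα1 : α ≤ 1 := ratio_le_one A
    have hlα : Real.log α ≤ 0 := Real.log_nonpos hαpos.le hα1
    have hLa : Real.log (2 / α) = Real.log 2 - Real.log α := Real.log_div (by norm_num) hαpos.ne'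
    have hLb : Real.log (1 / α) = - Real.log α := by rw [one_div, Real.log_inv]
    have hlog4 : 0 ≤ Real.log (2 / γ) ^ 4 := by positivity
    by_cases hC : γ * (Fintype.card G : ℝ) ≤ ((univ \ (A + A)).card : ℝ)
    · obtain ⟨V, x, hVc, hVA⟩ := increment (q := q) A hA γ h0 h1 hC
      have hcard : (0 : ℝ) < Fintype.card V := card_pos'
      set A' : Finset V := univ.filter (fun v : V => x + (v : G) ∈ A) with hA'def
      rw [← hα] at hVA hVc
      have hA'pos : (0 : ℝ) < A'.card := lt_of_lt_of_le (by positivity) hVA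
      have hA'ne : A'.Nonempty := Finset.card_pos.1 (by exact_mod_cast hA'pos)
      have hlt : Fintype.card V < Fintype.card G := by
        refine lt_of_le_of_ne (Fintype.card_subtype_le _) ?_
        intro hEq
        have hle : A'.card ≤ A.card := by
          refine Finset.card_le_card_of_injOn (fun v : V => x + (v : G)) ?_ ?_
          · intro v hv
            simpa [hA'def] using hv
          · intro a _ b _ hab
            exact Subtype.ext (add_left_cancel hab)
        have hle' : (A'.card : ℝ) ≤ A.card := by exact_mod_cast hle
        have : α * Fintype.card V = A.card := by
          rw [hEq, hα]; field_simp
        rw [mul_assoc, this] at hVA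
        linarith
      obtain ⟨W', x', hW'c, hW'⟩ := ih V A' hA'ne (by omega)
      set α' : ℝ := A'.card / Fintype.card V with hα'
      have hα'pos : 0 < α' := by positivity
      have hα'1 : α' ≤ 1 := ratio_le_one A'
      have hinc : 17 / 16 * α ≤ α' := by rw [hα', le_div_iff₀ hcard]; exact hVA
      have hlinc : Real.log (17 / 16) + Real.log α ≤ Real.log α' := by
        rw [← Real.log_mul (by norm_num) hαpos.ne']
        exact Real.log_le_log (by positivity) hinc
      have hlα' : Real.log α' ≤ 0 := Real.log_nonpos hα'pos.le hα'1
      have hLa' : Real.log (2 / α') = Real.log 2 - Real.log α' :=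
        Real.log_div (by norm_num) hα'pos.ne'
      have hLb' : Real.log (1 / α') = - Real.log α' := by rw [one_div, Real.log_inv]
      have hinj : Function.Injective V.subtype := V.injective_subtype
      refine ⟨W'.map V.subtype, x + x + (x' : G), ?_, ?_⟩
      · rw [← (Submodule.equivMapOfInjective _ hinj W').finrank_eq]
        have hpow : Real.log (2 / α') ^ 4 ≤ Real.log (2 / α) ^ 4 := by
          apply pow_le_pow_left₀
          · rw [hLa']; linarith
          · rw [hLa', hLa]; linarith
        have hb0 : 0 ≤ Real.log (1 / α') := by rw [hLb']; linarith
        have hstep : Real.log (17 / 16) + Real.log (1 / α') ≤ Real.log (1 / α) := by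
          rw [hLb', hLb]; linarith
        calc _ = ((Module.finrank (ZMod q) G : ℝ) - Module.finrank (ZMod q) V) +
              ((Module.finrank (ZMod q) V : ℝ) - Module.finrank (ZMod q) W') := by ring
          _ ≤ K1 * Real.log (17 / 16) * Real.log (2 / α) ^ 4 * Real.log (2 / γ) ^ 4 +
              K1 * Real.log (2 / α) ^ 4 * Real.log (1 / α') * Real.log (2 / γ) ^ 4 := by
              rw [hKC]
              refine add_le_add hVc (hW'c.trans ?_)
              gcongr
          _ = K1 * Real.log (2 / α) ^ 4 * (Real.log (17 / 16) + Real.log (1 / α')) *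
              Real.log (2 / γ) ^ 4 := by ring
          _ ≤ _ := by gcongr
      · have e1 : Nat.card (W'.map V.subtype) = Nat.card W' :=
          (Nat.card_congr (Submodule.equivMapOfInjective _ hinj W').toEquiv).symm
        rw [e1]
        refine hW'.trans ?_
        norm_cast
        refine Finset.card_le_card_of_injOn (fun v : V => x + x + (v : G)) ?_ ?_
        · intro v hv
          simp only [Finset.coe_filter, Set.mem_ofPred_eq, Finset.mem_add] at hv ⊢
          obtain ⟨⟨a, ha, b, hb, rfl⟩, hv⟩ := hv
          refine ⟨⟨x + a, ?_, x + b, ?_, ?_⟩, ?_⟩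
          · simpa [hA'def] using ha
          · simpa [hA'def] using hb
          · push_cast; abel
          · refine ⟨_, hv, ?_⟩
            simp
        · intro a _ b _ hab
          exact Subtype.ext (add_left_cancel hab)
    · push Not at hC
      refine ⟨⊤, 0, ?_, ?_⟩
      · rw [finrank_top, sub_self, hLa, hLb]
        have : 0 ≤ -Real.log α := by linarith
        positivity
      · have e : ((univ \ (A + A)).card : ℝ) = Fintype.card G - (A + A).card := by
          rw [Finset.card_sdiff_of_subset (Finset.subset_univ _), Finset.card_univ,
            Nat.cast_sub (Finset.card_le_univ _)]
        have e2 : Nat.card (⊤ : Submodule (ZMod q) G) = Fintype.card G := by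
          rw [← Nat.card_eq_fintype_card]
          exact Nat.card_congr (Equiv.Set.univ G)
        rw [e2]
        simp only [Submodule.mem_top, Finset.filter_true]
        linarith

end KM

/-- **Kelley–Meka: `A+A` almost covers a large affine subspace.** There is a constant `C > 0`
such that for every prime `q`, `n ≥ 1`, nonempty `A ⊆ 𝔽_q^n` with density `α`, and
`γ ∈ (0,1]`, there is an affine subspace `x + W` of codimension at most
`C·(log(2/α))^5·(log(2/γ))^4` with `|(A+A) ∩ (x+W)| ≥ (1-γ)·|W|`. -/
theorem statement6 :
    ∃ C > (0 : ℝ), ∀ q n : ℕ, q.Prime → 1 ≤ n →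
      ∀ A : Finset (Fin n → ZMod q), A.Nonempty → ∀ γ : ℝ, γ ∈ Set.Ioc (0 : ℝ) 1 →
        ∃ W : Submodule (ZMod q) (Fin n → ZMod q), ∃ x : Fin n → ZMod q,
          ((n : ℝ) - (Module.finrank (ZMod q) W : ℝ)) ≤
              C * Real.log (2 / ((A.card : ℝ) / (q : ℝ) ^ n)) ^ 5 * Real.log (2 / γ) ^ 4 ∧
          (1 - γ) * (Nat.card W : ℝ) ≤ (((A + A).filter fun v => v - x ∈ W).card : ℝ) := by
  have hK : 0 < KM.K1 := div_pos KM.C1_pos (Real.log_pos (by norm_num))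
  refine ⟨KM.K1, hK, ?_⟩
  intro q n hq hn A hA γ hγ
  haveI : Fact q.Prime := ⟨hq⟩
  haveI : NeZero q := ⟨hq.ne_zero⟩
  obtain ⟨W, x, h1, h2⟩ := KM.iterate (q := q) γ hγ.1 hγ.2
    (Fintype.card (Fin n → ZMod q)) (Fin n → ZMod q) A hA le_rfl
  have hα1 := KM.ratio_le_one A
  have hA' : (0 : ℝ) < A.card := by exact_mod_cast hA.card_pos
  have hαpos : (0 : ℝ) < (A.card : ℝ) / Fintype.card (Fin n → ZMod q) :=
    div_pos hA' KM.card_pos'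
  have hcard : (Fintype.card (Fin n → ZMod q) : ℝ) = (q : ℝ) ^ n := by
    simp [ZMod.card]
  rw [hcard] at h1 hα1 hαpos
  rw [Module.finrank_fin_fun] at h1
  refine ⟨W, x, h1.trans ?_, ?_⟩
  · set α : ℝ := (A.card : ℝ) / (q : ℝ) ^ n with hα
    have hle : Real.log (1 / α) ≤ Real.log (2 / α) := by
      apply Real.log_le_log (by positivity)
      gcongr
      norm_num
    calc _ ≤ KM.K1 * Real.log (2 / α) ^ 4 * Real.log (2 / α) * Real.log (2 / γ) ^ 4 := by
          gcongr
      _ = _ := by ring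
  · convert h2
    rfl
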